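/- arXiv:2205.14816 — 2 statements merged into one kernel-verified Lean document; each statement's English description precedes it below -/
import Mathlib

section
/- For every d > 0 and every symmetric norm l on ℝ^d, there exists a vector x ∈ S^{d-1} simultaneously satisfying: (1) |‖x‖_∞ − M_{ℓ_∞^{(d)}}| ≤ 2/√d; (2) |l(x) − M_{l^{(d)}}| ≤ 2·b_{l^{(d)}}/√d; and (3) |{i : |x_i| > 1/(K√d)}| > d/2 for some universal constant K. -/
open MeasureTheory
open scoped ENNReal

def IsSymmetricNorm {d : ℕ} (l : (Fin d → ℝ) → ℝ) : Prop :=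
  (∀ x y, l (x + y) ≤ l x + l y) ∧
  (∀ (c : ℝ) (x), l (c • x) = |c| * l x) ∧
  (∀ x, x ≠ 0 → 0 < l x) ∧
  (∀ (σ : Equiv.Perm (Fin d)) (x), l (fun i => x (σ i)) = l x) ∧
  (∀ x, l (fun i => |x i|) = l x)

noncomputable def enorm2 {d : ℕ} (x : Fin d → ℝ) : ℝ :=
  Real.sqrt (∑ i, x i ^ 2)

/-- the ℓ∞-norm on `Fin d → ℝ`. -/
noncomputable def linf {d : ℕ} (x : Fin d → ℝ) : ℝ :=
  ((Finset.univ.sup fun i => (⟨|x i|, abs_nonneg _⟩ : NNReal)) : NNReal)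

open ProbabilityTheory

lemma enorm2_sq {d : ℕ} (x : Fin d → ℝ) : enorm2 x ^ 2 = x ⬝ᵥ x := by
  unfold enorm2
  rw [Real.sq_sqrt (Finset.sum_nonneg fun i _ => sq_nonneg _)]
  simp [dotProduct, sq]

lemma enorm2_nonneg {d : ℕ} (x : Fin d → ℝ) : 0 ≤ enorm2 x := Real.sqrt_nonneg _

lemma enorm2_smul {d : ℕ} (c : ℝ) (hc : 0 ≤ c) (x : Fin d → ℝ) :
    enorm2 (c • x) = c * enorm2 x := by
  have h : enorm2 (c • x) ^ 2 = (c * enorm2 x) ^ 2 := by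
    rw [mul_pow, enorm2_sq, enorm2_sq, smul_dotProduct, dotProduct_smul]
    simp only [smul_eq_mul]; ring
  exact (pow_left_inj₀ (enorm2_nonneg _) (mul_nonneg hc (enorm2_nonneg _)) two_ne_zero).1 h

lemma exists_orth {d : ℕ} (v w : Fin d → ℝ) (h : enorm2 v = enorm2 w) :
    ∃ T ∈ Matrix.orthogonalGroup (Fin d) ℝ, T.mulVec v = w := by
  classical
  by_cases hvw : v = w
  · exact ⟨1, one_mem _, by simp [hvw]⟩
  set u := v - w with hu
  have hu0 : u ⬝ᵥ u ≠ 0 := by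
    rw [Ne, dotProduct_self_eq_zero, hu, sub_eq_zero]; exact hvw
  have hvv : v ⬝ᵥ v = w ⬝ᵥ w := by rw [← enorm2_sq, ← enorm2_sq, h]
  have h2 : 2 * (u ⬝ᵥ v) = u ⬝ᵥ u := by
    simp only [hu, sub_dotProduct, dotProduct_sub]
    rw [dotProduct_comm v w]; linarith
  refine ⟨1 - (2 / (u ⬝ᵥ u)) • Matrix.vecMulVec u u, ?_, ?_⟩
  · rw [Matrix.mem_orthogonalGroup_iff]
    have ht : (1 - (2 / (u ⬝ᵥ u)) • Matrix.vecMulVec u u).transpose =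
        1 - (2 / (u ⬝ᵥ u)) • Matrix.vecMulVec u u := by
      ext i j
      simp [Matrix.vecMulVec, Matrix.one_apply, eq_comm, mul_comm]
    rw [ht]
    have hm : Matrix.vecMulVec u u * Matrix.vecMulVec u u
        = (u ⬝ᵥ u) • Matrix.vecMulVec u u := by
      rw [Matrix.vecMulVec_mul_vecMulVec]
      ext i j; simp [Matrix.vecMulVec]; ring
    simp only [sub_mul, mul_sub, one_mul, mul_one, smul_mul_assoc, mul_smul_comm, hm]
    ext i j
    simp
    field_simp
    ring
  · rw [Matrix.sub_mulVec, Matrix.one_mulVec, Matrix.smul_mulVec, Matrix.vecMulVec_mulVec]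
    ext i
    simp
    have : 2 / (u ⬝ᵥ u) * ((u ⬝ᵥ v) * u i) = u i := by
      field_simp; linear_combination (u i) * h2
    rw [this, hu]; simp

noncomputable def chf {d : ℕ} (μ : Measure (Fin d → ℝ)) (ξ : Fin d → ℝ) : ℂ :=
  ∫ x, Complex.exp ((ξ ⬝ᵥ x : ℝ) * Complex.I) ∂μ

lemma cont_dot {d : ℕ} (ξ : Fin d → ℝ) : Continuous fun x : Fin d → ℝ => ξ ⬝ᵥ x := by
  unfold dotProduct; fun_prop

lemma chf_inv {d : ℕ} (μ : Measure (Fin d → ℝ))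
    (hinv : ∀ T ∈ Matrix.orthogonalGroup (Fin d) ℝ, μ.map T.mulVec = μ)
    (ξ η : Fin d → ℝ) (h : enorm2 ξ = enorm2 η) : chf μ ξ = chf μ η := by
  obtain ⟨T, hT, hTv⟩ := exists_orth ξ η h
  have hS : star T ∈ Matrix.orthogonalGroup (Fin d) ℝ := Unitary.star_mem hT
  have h1 := hinv _ hS
  have hc : Continuous (star T).mulVec := by
    exact Continuous.matrix_mulVec continuous_const continuous_id
  unfold chf
  conv_lhs => rw [← h1]
  rw [integral_map hc.measurable.aemeasurable]
  · congr 1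
    ext x
    rw [Matrix.dotProduct_mulVec, ← hTv, Matrix.star_eq_conjTranspose,
      Matrix.conjTranspose_eq_transpose_of_trivial, Matrix.vecMul_transpose]
  · apply Continuous.aestronglyMeasurable
    have := cont_dot ξ
    fun_prop

noncomputable def gam (d : ℕ) : Measure (Fin d → ℝ) := Measure.pi fun _ => gaussianReal 0 1

instance (d : ℕ) : IsProbabilityMeasure (gam d) := by unfold gam; infer_instance

lemma chf_gam {d : ℕ} (ξ : Fin d → ℝ) :
    chf (gam d) ξ = Complex.exp (-(enorm2 ξ ^ 2 : ℝ) / 2) := by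
  unfold chf gam
  have : ∀ x : Fin d → ℝ, Complex.exp ((ξ ⬝ᵥ x : ℝ) * Complex.I) =
      ∏ i, Complex.exp ((ξ i : ℂ) * (x i) * Complex.I) := by
    intro x
    rw [← Complex.exp_sum]; congr 1
    simp [dotProduct, Finset.sum_mul]
  simp_rw [this]
  rw [integral_fintype_prod_eq_prod (fun i (y : ℝ) => Complex.exp ((ξ i : ℂ) * y * Complex.I))]
  have h2 : ∀ t : ℝ, ∫ y : ℝ, Complex.exp ((t : ℂ) * y * Complex.I) ∂(gaussianReal 0 1) =
      Complex.exp (-(t ^ 2 : ℝ) / 2) := by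
    intro t
    rw [← charFun_apply_real, charFun_gaussianReal]
    congr 1; simp; ring
  simp_rw [h2]
  rw [← Complex.exp_sum]; congr 1
  rw [enorm2_sq]; simp [dotProduct, sq]
  simp [neg_div, Finset.sum_neg_distrib, Finset.sum_div]

lemma measurable_enorm2 {d : ℕ} : Measurable (enorm2 : (Fin d → ℝ) → ℝ) := by
  unfold enorm2; fun_prop

lemma rep {d : ℕ} (μ : Measure (Fin d → ℝ)) [IsProbabilityMeasure μ]
    (hsph : μ {x | enorm2 x = 1} = 1)
    (hinv : ∀ T ∈ Matrix.orthogonalGroup (Fin d) ℝ, μ.map T.mulVec = μ) :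
    ((gam d).prod μ).map (fun p => enorm2 p.1 • p.2) = gam d := by
  have hae : ∀ᵐ x ∂μ, enorm2 x = 1 := by
    have hms : MeasurableSet {x : Fin d → ℝ | enorm2 x = 1} :=
      measurable_enorm2 (measurableSet_singleton 1)
    exact (prob_compl_eq_zero_iff hms).2 hsph
  have hm : Measurable (fun p : (Fin d → ℝ) × (Fin d → ℝ) => enorm2 p.1 • p.2) := by
    have := @measurable_enorm2 d
    fun_prop
  have : IsProbabilityMeasure (((gam d).prod μ).map (fun p => enorm2 p.1 • p.2)) :=
    Measure.isProbabilityMeasure_map hm.aemeasurable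
  apply Measure.ext_of_charFunDual
  ext L
  set ξ : Fin d → ℝ := fun i => L (Pi.single i 1) with hξ
  have hL : ∀ x, L x = ξ ⬝ᵥ x := by
    intro x
    conv_lhs => rw [← Finset.univ_sum_single x]
    rw [map_sum, dotProduct]
    refine Finset.sum_congr rfl fun i _ => ?_
    have : (Pi.single i (x i) : Fin d → ℝ) = x i • Pi.single i 1 := by
      ext j; by_cases h : j = i
      · subst h; simp
      · simp [h]
    rw [this, map_smul, smul_eq_mul, mul_comm]
  rw [charFunDual_apply, charFunDual_apply]
  simp_rw [hL]
  change _ = chf (gam d) ξ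
  have hd : Measurable fun x : Fin d → ℝ => ξ ⬝ᵥ x := (cont_dot ξ).measurable
  rw [integral_map hm.aemeasurable (by
    apply Measurable.aestronglyMeasurable; fun_prop)]
  rw [integral_prod]
  swap
  · refine Integrable.of_bound (C := 1) ?_ ?_
    · apply Measurable.aestronglyMeasurable
      have := hd.comp hm
      simp only [Function.comp_def] at this
      fun_prop
    · exact Filter.Eventually.of_forall fun p => by rw [Complex.norm_exp_ofReal_mul_I]
  have h1 : ∀ g : Fin d → ℝ, ∫ x, Complex.exp ((ξ ⬝ᵥ (enorm2 g • x) : ℝ) * Complex.I) ∂μ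
      = ∫ x, Complex.exp ((enorm2 ξ * (g ⬝ᵥ x) : ℝ) * Complex.I) ∂μ := by
    intro g
    have := chf_inv μ hinv (enorm2 g • ξ) (enorm2 ξ • g) (by
      rw [enorm2_smul _ (enorm2_nonneg _), enorm2_smul _ (enorm2_nonneg _), mul_comm])
    simpa [chf, smul_dotProduct, dotProduct_smul] using this
  simp only [h1]
  rw [integral_integral_swap]
  swap
  · refine Integrable.of_bound (C := 1) ?_ ?_
    · apply Measurable.aestronglyMeasurable
      simp only [Function.uncurry_def, dotProduct]
      fun_prop
    · exact Filter.Eventually.of_forall fun p => by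
        rw [Function.uncurry_def, Complex.norm_exp_ofReal_mul_I]
  have h3 : ∀ᵐ x ∂μ, ∫ g, Complex.exp ((enorm2 ξ * (g ⬝ᵥ x) : ℝ) * Complex.I) ∂(gam d)
      = chf (gam d) ξ := by
    filter_upwards [hae] with x hx
    have : chf (gam d) (enorm2 ξ • x) = chf (gam d) ξ := by
      rw [chf_gam, chf_gam, enorm2_smul _ (enorm2_nonneg _), hx, mul_one]
    rw [← this]
    simp only [chf, smul_dotProduct, smul_eq_mul]
    simp_rw [dotProduct_comm x]
  rw [integral_congr_ae h3]
  simp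
lemma abs_le_linf {d : ℕ} (x : Fin d → ℝ) (i : Fin d) : |x i| ≤ linf x := by
  unfold linf
  have := Finset.le_sup (f := fun i => (⟨|x i|, abs_nonneg _⟩ : NNReal)) (Finset.mem_univ i)
  exact_mod_cast this

lemma linf_le_iff {d : ℕ} (x : Fin d → ℝ) {a : ℝ} (ha : 0 ≤ a) :
    linf x ≤ a ↔ ∀ i, |x i| ≤ a := by
  refine ⟨fun h i => (abs_le_linf x i).trans h, fun h => ?_⟩
  unfold linf
  have : (Finset.univ.sup fun i => (⟨|x i|, abs_nonneg _⟩ : NNReal)) ≤ ⟨a, ha⟩ :=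
    Finset.sup_le fun i _ => h i
  exact_mod_cast this

lemma linf_nonneg {d : ℕ} (x : Fin d → ℝ) : 0 ≤ linf x := NNReal.coe_nonneg _

lemma exists_linf {d : ℕ} (hd : 0 < d) (x : Fin d → ℝ) : ∃ i, linf x = |x i| := by
  have : Nonempty (Fin d) := ⟨⟨0, hd⟩⟩
  obtain ⟨i, -, hi⟩ := Finset.exists_mem_eq_sup Finset.univ Finset.univ_nonempty
    (fun i => (⟨|x i|, abs_nonneg _⟩ : NNReal))
  exact ⟨i, congrArg NNReal.toReal hi⟩

lemma linf_smul {d : ℕ} (c : ℝ) (hc : 0 ≤ c) (x : Fin d → ℝ) : linf (c • x) = c * linf x := by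
  apply le_antisymm
  · rw [linf_le_iff _ (mul_nonneg hc (linf_nonneg x))]
    intro i
    simp only [Pi.smul_apply, smul_eq_mul, abs_mul, abs_of_nonneg hc]
    exact mul_le_mul_of_nonneg_left (abs_le_linf x i) hc
  · rcases Nat.eq_zero_or_pos d with h | h
    · subst h
      have h0 : linf x ≤ 0 := (linf_le_iff x le_rfl).2 fun i => i.elim0
      rw [le_antisymm h0 (linf_nonneg x), mul_zero]; exact linf_nonneg _
    · obtain ⟨i, hi⟩ := exists_linf h x
      rw [hi]
      have := abs_le_linf (c • x) i
      simpa [abs_mul, abs_of_nonneg hc] using this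

lemma linf_ge {d : ℕ} (hd : 0 < d) (x : Fin d → ℝ) (hx : enorm2 x = 1) :
    1 / Real.sqrt d ≤ linf x := by
  have h1 : (1 : ℝ) ≤ d * linf x ^ 2 := by
    have : ∑ i, x i ^ 2 = 1 := by
      unfold enorm2 at hx
      have := Real.sqrt_eq_one.1 hx
      exact this
    calc (1 : ℝ) = ∑ i, x i ^ 2 := this.symm
      _ ≤ ∑ i : Fin d, linf x ^ 2 := Finset.sum_le_sum fun i _ => by
          rw [← sq_abs]; exact pow_le_pow_left₀ (abs_nonneg _) (abs_le_linf x i) 2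
      _ = d * linf x ^ 2 := by simp
  have hd' : (0 : ℝ) < d := by exact_mod_cast hd
  rw [div_le_iff₀ (Real.sqrt_pos.2 hd')]
  rw [← abs_of_nonneg (mul_nonneg (linf_nonneg x) (Real.sqrt_nonneg _)), ← abs_one,
    ← sq_le_sq, mul_pow, Real.sq_sqrt hd'.le]
  linarith

lemma linf_le_one {d : ℕ} (x : Fin d → ℝ) (hx : enorm2 x = 1) : linf x ≤ 1 := by
  rw [linf_le_iff _ zero_le_one]
  intro i
  have : ∑ i, x i ^ 2 = 1 := Real.sqrt_eq_one.1 hx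
  have h2 : x i ^ 2 ≤ 1 := by
    rw [← this]
    exact Finset.single_le_sum (f := fun i => x i ^ 2) (fun i _ => sq_nonneg _) (Finset.mem_univ i)
  exact (sq_le_one_iff_abs_le_one _).1 h2

lemma exists_sorted {d : ℕ} (l : (Fin d → ℝ) → ℝ) (hl : IsSymmetricNorm l) (x : Fin d → ℝ)
    (τ : ℝ) : ∃ u : Fin d → ℝ, Monotone u ∧ (∀ i, 0 ≤ u i) ∧ enorm2 u = enorm2 x ∧
      linf u = linf x ∧ l u = l x ∧
      (Finset.univ.filter fun i => τ < |u i|).card =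
        (Finset.univ.filter fun i => τ < |x i|).card := by
  set a : Fin d → ℝ := fun i => |x i| with ha
  set σ := Tuple.sort a
  refine ⟨fun i => a (σ i), Tuple.monotone_sort a, fun i => abs_nonneg _, ?_, ?_, ?_, ?_⟩
  · unfold enorm2
    congr 1
    rw [Equiv.sum_comp σ (fun i => a i ^ 2)]
    simp [ha]
  · apply le_antisymm
    · rw [linf_le_iff _ (linf_nonneg _)]; intro i; simp [ha]; exact abs_le_linf x _
    · rw [linf_le_iff _ (linf_nonneg _)]; intro i
      have := abs_le_linf (fun i => a (σ i)) (σ.symm i)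
      simpa [ha] using this
  · rw [hl.2.2.2.1 σ a, ha, hl.2.2.2.2]
  · refine Finset.card_bij (fun i _ => σ i) ?_ ?_ ?_
    · intro i hi; simpa [ha] using hi
    · intro i _ j _ h; exact σ.injective h
    · intro j hj; exact ⟨σ.symm j, by simpa [ha] using hj, by simp⟩

lemma linf_mono {d : ℕ} (hd : 0 < d) (u : Fin d → ℝ) (hm : Monotone u) (h0 : ∀ i, 0 ≤ u i) :
    linf u = u ⟨d - 1, by omega⟩ := by
  apply le_antisymm
  · rw [linf_le_iff _ (h0 _)]
    intro i; rw [abs_of_nonneg (h0 i)]; apply hm; rw [Fin.le_def]; simp; omega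
  · have := abs_le_linf u ⟨d - 1, by omega⟩
    rwa [abs_of_nonneg (h0 _)] at this

lemma l_nonneg {d : ℕ} {l : (Fin d → ℝ) → ℝ} (hl : IsSymmetricNorm l) (x) : 0 ≤ l x := by
  by_cases h : x = 0
  · have := hl.2.1 0 0
    rw [h]; simp at this; exact this.ge
  · exact (hl.2.2.1 x h).le

lemma l_cont {d : ℕ} {l : (Fin d → ℝ) → ℝ} (hl : IsSymmetricNorm l) : Continuous l := by
  have h0 : l 0 = 0 := by simpa using hl.2.1 0 0
  have hb : ∀ x, l x ≤ ∑ i, |x i| * l (Pi.single i 1) := by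
    intro x
    have h1 : ∀ s : Finset (Fin d), l (∑ i ∈ s, Pi.single i (x i)) ≤
        ∑ i ∈ s, |x i| * l (Pi.single i 1) := by
      intro s
      induction s using Finset.induction_on with
      | empty => simp [h0]
      | insert a s ha ih =>
        rw [Finset.sum_insert ha, Finset.sum_insert ha]
        refine (hl.1 _ _).trans (add_le_add ?_ ih)
        rw [← hl.2.1]
        apply le_of_eq; congr 1
        ext j; by_cases h : j = a
        · subst h; simp
        · simp [h]
    have := h1 Finset.univ
    rwa [Finset.univ_sum_single] at this
  have hs : ∀ x y, |l y - l x| ≤ l (y - x) := by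
    intro x y
    have e1 := hl.1 (y - x) x
    have e2 := hl.1 (x - y) y
    have e3 : l (x - y) = l (y - x) := by
      have := hl.2.1 (-1) (y - x)
      simpa using this
    simp only [sub_add_cancel] at e1 e2
    rw [abs_le]; constructor <;> linarith
  rw [continuous_iff_continuousAt]
  intro x
  rw [ContinuousAt, tendsto_iff_dist_tendsto_zero]
  have hc : Filter.Tendsto (fun y : Fin d → ℝ => ∑ i, |(y - x) i| * l (Pi.single i 1)) (nhds x)
      (nhds 0) := by
    have : Continuous (fun y : Fin d → ℝ => ∑ i, |(y - x) i| * l (Pi.single i 1)) := by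
      simp only [Pi.sub_apply]; fun_prop
    have h := this.tendsto x
    simpa using h
  refine squeeze_zero (fun _ => dist_nonneg) (fun y => ?_) hc
  rw [Real.dist_eq]
  exact (hs x y).trans (hb _)

lemma ivt_main {d : ℕ} (hd : 0 < d) (l : (Fin d → ℝ) → ℝ) (hl : IsSymmetricNorm l)
    (x y : Fin d → ℝ) (M c τ δ : ℝ) (hx1 : enorm2 x = 1) (hy1 : enorm2 y = 1)
    (hxc : |linf x - c| ≤ δ) (hyc : |linf y - c| ≤ δ) (hxM : l x ≤ M) (hyM : M ≤ l y)
    (hx3 : (d : ℝ) / 2 < ((Finset.univ.filter fun i => τ < |x i|).card : ℝ))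
    (hy3 : (d : ℝ) / 2 < ((Finset.univ.filter fun i => τ < |y i|).card : ℝ)) :
    ∃ z : Fin d → ℝ, enorm2 z = 1 ∧ |linf z - c| ≤ δ ∧ l z = M ∧
      (d : ℝ) / 2 < ((Finset.univ.filter fun i => τ < |z i|).card : ℝ) := by
  obtain ⟨u, um, u0, u1, ui, ul, uc⟩ := exists_sorted l hl x τ
  obtain ⟨v, vm, v0, v1, vi, vl, vc⟩ := exists_sorted l hl y τ
  rw [← uc] at hx3; rw [← vc] at hy3
  rw [← ui] at hxc; rw [← vi] at hyc
  rw [← ul] at hxM; rw [← vl] at hyM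
  rw [← u1] at hx1; rw [← v1] at hy1
  clear uc vc ui vi ul vl u1 v1
  set z : ℝ → Fin d → ℝ := fun s i => Real.sqrt ((1 - s) * u i ^ 2 + s * v i ^ 2) with hz
  have hzc : Continuous fun s => l (z s) := by
    apply (l_cont hl).comp
    rw [continuous_pi_iff]; intro i; simp only [hz]; fun_prop
  have hz0 : z 0 = u := by ext i; simp [hz, Real.sqrt_sq (u0 i)]
  have hz1 : z 1 = v := by ext i; simp [hz, Real.sqrt_sq (v0 i)]
  obtain ⟨s, ⟨hs0, hs1⟩, hs⟩ : M ∈ (fun s => l (z s)) '' Set.Icc 0 1 := by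
    apply intermediate_value_Icc zero_le_one hzc.continuousOn
    simp only [hz0, hz1]; exact ⟨hxM, hyM⟩
  have hnn : ∀ i, 0 ≤ (1 - s) * u i ^ 2 + s * v i ^ 2 := fun i => by
    have := sub_nonneg.2 hs1; positivity
  have hzm : Monotone (z s) := by
    intro i j hij
    apply Real.sqrt_le_sqrt
    have h1 := pow_le_pow_left₀ (u0 i) (um hij) 2
    have h2 := pow_le_pow_left₀ (v0 i) (vm hij) 2
    have := sub_nonneg.2 hs1
    gcongr
  have hzn : ∀ i, 0 ≤ z s i := fun i => Real.sqrt_nonneg _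
  have hlow : ∀ i, min (u i) (v i) ≤ z s i := by
    intro i
    apply Real.le_sqrt_of_sq_le
    have hm0 : 0 ≤ min (u i) (v i) := le_min (u0 i) (v0 i)
    have h1 := pow_le_pow_left₀ hm0 (min_le_left (u i) (v i)) 2
    have h2 := pow_le_pow_left₀ hm0 (min_le_right (u i) (v i)) 2
    nlinarith
  have hupp : ∀ i, z s i ≤ max (u i) (v i) := by
    intro i
    have hm0 : 0 ≤ max (u i) (v i) := (u0 i).trans (le_max_left _ _)
    apply Real.sqrt_le_iff.2 ⟨hm0, ?_⟩
    have h1 := pow_le_pow_left₀ (u0 i) (le_max_left (u i) (v i)) 2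
    have h2 := pow_le_pow_left₀ (v0 i) (le_max_right (u i) (v i)) 2
    nlinarith
  refine ⟨z s, ?_, ?_, hs, ?_⟩
  · have a1 : ∑ i, u i ^ 2 = 1 := Real.sqrt_eq_one.1 hx1
    have a2 : ∑ i, v i ^ 2 = 1 := Real.sqrt_eq_one.1 hy1
    unfold enorm2
    rw [Real.sqrt_eq_one]
    simp only [hz, Real.sq_sqrt (hnn _), Finset.sum_add_distrib, ← Finset.mul_sum, a1, a2]
    ring
  · rw [linf_mono hd _ hzm hzn]
    rw [linf_mono hd _ um u0] at hxc
    rw [linf_mono hd _ vm v0] at hyc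
    have h1 := hlow ⟨d - 1, by omega⟩
    have h2 := hupp ⟨d - 1, by omega⟩
    rw [abs_le] at *
    constructor
    · rcases min_le_iff.1 h1 with h | h <;> linarith
    · rcases le_max_iff.1 h2 with h | h <;> linarith
  · have key : ∀ w : Fin d → ℝ, (∀ i, 0 ≤ w i) → (∀ i, τ < w i → τ < z s i) →
        (d : ℝ) / 2 < ((Finset.univ.filter fun i => τ < |w i|).card : ℝ) →
        (d : ℝ) / 2 < ((Finset.univ.filter fun i => τ < |z s i|).card : ℝ) := by
      intro w w0 hw h
      refine h.trans_le ?_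
      exact_mod_cast Finset.card_le_card (fun i hi => by
        simp only [Finset.mem_filter, Finset.mem_univ, true_and] at hi ⊢
        rw [abs_of_nonneg (w0 i)] at hi
        rw [abs_of_nonneg (hzn i)]; exact hw i hi)
    have hU : IsUpperSet {i | τ < u i} := fun i j hij hi => lt_of_lt_of_le hi (um hij)
    have hV : IsUpperSet {i | τ < v i} := fun i j hij hi => lt_of_lt_of_le hi (vm hij)
    rcases hU.total hV with h | h
    · exact key u u0 (fun i hi => lt_of_lt_of_le (lt_min hi (h hi)) (hlow i)) hx3
    · exact key v v0 (fun i hi => lt_of_lt_of_le (lt_min (h hi) hi) (hlow i)) hy3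
lemma gauss4 : ∫ y, y ^ 4 ∂(gaussianReal 0 1) = 3 := by
  have h := iteratedDeriv_mgf_zero (X := fun y : ℝ => y) (μ := gaussianReal 0 1)
    (by rw [integrableExpSet_fun_id_gaussianReal]; simp) 4
  simp only [Pi.pow_apply] at h
  rw [← h, mgf_fun_id_gaussianReal]
  have e0 : (fun t : ℝ => Real.exp (0 * t + ((1 : NNReal) : ℝ) * t ^ 2 / 2)) =
      fun t => Real.exp (t ^ 2 / 2) := by ext t; simp
  have hE : ∀ t : ℝ, HasDerivAt (fun t : ℝ => Real.exp (t ^ 2 / 2)) (t * Real.exp (t ^ 2 / 2)) t := by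
    intro t
    have := ((hasDerivAt_pow 2 t).div_const 2).exp
    convert this using 1
    simp; ring
  have e1 : deriv (fun t : ℝ => Real.exp (t ^ 2 / 2)) = fun t => t * Real.exp (t ^ 2 / 2) := by
    ext t; exact (hE t).deriv
  have e2 : deriv (fun t : ℝ => t * Real.exp (t ^ 2 / 2)) =
      fun t => (1 + t ^ 2) * Real.exp (t ^ 2 / 2) := by
    ext t
    rw [((hasDerivAt_id' t).fun_mul (hE t)).deriv]; ring
  have e3 : deriv (fun t : ℝ => (1 + t ^ 2) * Real.exp (t ^ 2 / 2)) =
      fun t => (3 * t + t ^ 3) * Real.exp (t ^ 2 / 2) := by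
    ext t
    rw [(((hasDerivAt_pow 2 t).const_add 1).fun_mul (hE t)).deriv]; simp; ring
  have e4 : deriv (fun t : ℝ => (3 * t + t ^ 3) * Real.exp (t ^ 2 / 2)) =
      fun t => (3 + 6 * t ^ 2 + t ^ 4) * Real.exp (t ^ 2 / 2) := by
    ext t
    rw [((((hasDerivAt_id' t).const_mul 3).fun_add (hasDerivAt_pow 3 t)).fun_mul (hE t)).deriv]
    simp; ring
  rw [e0]
  simp only [iteratedDeriv_succ, iteratedDeriv_zero, e1, e2, e3, e4]
  simp

lemma gauss2 : ∫ y, y ^ 2 ∂(gaussianReal 0 1) = 1 := by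
  have h := variance_fun_id_gaussianReal (μ := 0) (v := 1)
  rw [variance_eq_integral (by fun_prop)] at h
  simpa using h

noncomputable def qt (s : ℝ) : ℝ := (gaussianReal 0 1).real {y | s < |y|}

instance : NullSingletonClass (gaussianReal 0 1) := nullSingletonClass_gaussianReal one_ne_zero

lemma gauss_symm (s : ℝ) : (gaussianReal 0 1).real (Set.Iio (-s)) =
    (gaussianReal 0 1).real (Set.Ioi s) := by
  have h : (gaussianReal 0 1).map (fun x ↦ -x) = gaussianReal 0 1 := by
    rw [gaussianReal_map_neg]; simp
  conv_lhs => rw [← h]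
  rw [map_measureReal_apply measurable_neg measurableSet_Iio]
  congr 1; ext; simp

lemma qt_eq {s : ℝ} (hs : 0 ≤ s) : qt s = 2 * (gaussianReal 0 1).real (Set.Ioi s) := by
  have : {y : ℝ | s < |y|} = Set.Ioi s ∪ Set.Iio (-s) := by
    ext y; simp [lt_abs]; constructor <;> rintro (h | h) <;> first | (left; linarith) | (right; linarith)
  unfold qt
  rw [this, measureReal_union _ measurableSet_Iio, gauss_symm, two_mul]
  rw [Set.disjoint_left]; intro y h1 h2; simp at h1 h2; linarith

lemma tail_shift (s t : ℝ) (ht : 0 ≤ t) : (gaussianReal 0 1).real (Set.Ioi (s + t)) ≤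
    Real.exp (-(t * s + t ^ 2 / 2)) * (gaussianReal 0 1).real (Set.Ioi s) := by
  have hr : ∀ A : Set ℝ, (gaussianReal 0 1).real A = ∫ y in A, gaussianPDFReal 0 1 y := by
    intro A
    rw [Measure.real, gaussianReal_apply_eq_integral _ one_ne_zero, ENNReal.toReal_ofReal]
    exact integral_nonneg fun y => gaussianPDFReal_nonneg _ _ _
  rw [hr, hr, ← integral_const_mul]
  have h1 : ∫ y in Set.Ioi (s + t), gaussianPDFReal 0 1 y
      = ∫ y in Set.Ioi s, gaussianPDFReal 0 1 (y + t) := by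
    have := (measurePreserving_add_right volume t).setIntegral_preimage_emb
      (measurableEmbedding_addRight t) (gaussianPDFReal 0 1) (Set.Ioi (s + t))
    rw [← this]; congr 2; ext y; simp
  rw [h1]
  apply setIntegral_mono_on
  · exact ((integrable_gaussianPDFReal 0 1).comp_add_right t).integrableOn
  · exact ((integrable_gaussianPDFReal 0 1).const_mul _).integrableOn
  · exact measurableSet_Ioi
  · intro y hy
    simp only [gaussianPDFReal]
    rw [mul_left_comm, ← Real.exp_add]
    apply mul_le_mul_of_nonneg_left _ (by positivity)
    apply Real.exp_le_exp.2
    simp only [sub_zero, NNReal.coe_one, mul_one]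
    have : s < y := hy
    nlinarith

lemma qt_shift (s t : ℝ) (hs : 0 ≤ s) (ht : 0 ≤ t) :
    qt (s + t) ≤ Real.exp (-(t * s + t ^ 2 / 2)) * qt s := by
  rw [qt_eq hs, qt_eq (add_nonneg hs ht)]
  have := tail_shift s t ht
  linarith

lemma qt_nonneg (s : ℝ) : 0 ≤ qt s := measureReal_nonneg

lemma qt_le_one (s : ℝ) : qt s ≤ 1 := measureReal_le_one

lemma qt_ge (s : ℝ) : (gaussianReal 0 1).real {y | s ≤ |y|} ≤ qt s := by
  unfold qt
  have h0 : (gaussianReal 0 1).real {s, -s} = 0 := by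
    rw [Measure.real, (Set.toFinite _).measure_zero]; simp
  calc _ ≤ (gaussianReal 0 1).real ({y | s < |y|} ∪ {s, -s}) := by
        refine measureReal_mono ?_ (measure_ne_top _ _)
        intro y hy
        rcases lt_or_eq_of_le (show s ≤ |y| from hy) with h | h
        · left; exact h
        · right
          rcases abs_choice y with h' | h'
          · left; rw [h, h']
          · right; simp; rw [h, h']; simp
    _ ≤ _ := measureReal_union_le _ _
    _ = _ := by rw [h0, add_zero]

lemma gauss_small (t : ℝ) (ht : 0 ≤ t) : (gaussianReal 0 1).real {y | |y| ≤ t} ≤ 2 * t := by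
  have hs : {y : ℝ | |y| ≤ t} = Set.Icc (-t) t := by ext; simp [abs_le]
  rw [hs, Measure.real, gaussianReal_apply_eq_integral _ one_ne_zero, ENNReal.toReal_ofReal
    (integral_nonneg fun y => gaussianPDFReal_nonneg _ _ _)]
  calc ∫ y in Set.Icc (-t) t, gaussianPDFReal 0 1 y ≤ ∫ y in Set.Icc (-t) t, (1 : ℝ) := by
        apply setIntegral_mono_on
        · exact (integrable_gaussianPDFReal 0 1).integrableOn
        · simp
        · exact measurableSet_Icc
        · intro y _
          simp only [gaussianPDFReal]
          apply mul_le_one₀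
          · apply inv_le_one_of_one_le₀
            rw [Real.one_le_sqrt]
            have := Real.pi_gt_three
            simp; linarith
          · positivity
          · rw [Real.exp_le_one_iff]; have := sq_nonneg (y - 0); apply div_nonpos_of_nonpos_of_nonneg
            · linarith
            · simp
    _ = 2 * t := by
        simp [measureReal_def]
        rw [ENNReal.toReal_ofReal (by linarith)]; ring

lemma gam_eval {d : ℕ} (i : Fin d) {A : Set ℝ} (hA : MeasurableSet A) :
    (gam d).real {g | g i ∈ A} = (gaussianReal 0 1).real A := by
  have := (measurePreserving_eval (fun _ : Fin d => gaussianReal 0 1) i).measure_preimage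
    hA.nullMeasurableSet
  unfold gam
  rw [Measure.real, Measure.real, ← this]; rfl

lemma gam_linf_le {d : ℕ} (s : ℝ) (hs : 0 ≤ s) :
    (gam d).real {g | linf g ≤ s} = (1 - qt s) ^ d := by
  have h1 : {g : Fin d → ℝ | linf g ≤ s} = Set.univ.pi fun _ => {y | |y| ≤ s} := by
    ext g; simp [linf_le_iff _ hs]
  have h2 : (gaussianReal 0 1).real {y | |y| ≤ s} = 1 - qt s := by
    have := probReal_compl_eq_one_sub (μ := gaussianReal 0 1) (s := {y : ℝ | s < |y|})
      (measurableSet_lt measurable_const (by fun_prop))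
    unfold qt; rw [← this]; congr 1; ext y; simp
  rw [h1, Measure.real, gam, Measure.pi_pi, ENNReal.toReal_prod, ← h2]
  simp [Measure.real]

lemma gam_linf_ge {d : ℕ} (hd : 0 < d) (s : ℝ) :
    (gam d).real {g | s ≤ linf g} ≤ d * qt s := by
  calc _ ≤ (gam d).real (⋃ i, {g : Fin d → ℝ | g i ∈ {y : ℝ | s ≤ |y|}}) := by
        refine measureReal_mono ?_ (measure_ne_top _ _)
        intro g hg
        obtain ⟨i, hi⟩ := exists_linf hd g
        simp only [Set.mem_iUnion]
        exact ⟨i, by rw [Set.mem_ofPred_eq, Set.mem_ofPred_eq, ← hi]; exact hg⟩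
    _ ≤ ∑ i, (gam d).real {g : Fin d → ℝ | g i ∈ {y : ℝ | s ≤ |y|}} :=
        measureReal_iUnion_fintype_le _
    _ ≤ ∑ i : Fin d, qt s := Finset.sum_le_sum fun i _ => by
        rw [gam_eval i (measurableSet_le measurable_const (by fun_prop))]; exact qt_ge s
    _ = d * qt s := by simp

lemma memLp_sq_gauss : MemLp (fun y : ℝ => y ^ 2) 2 (gaussianReal 0 1) := by
  have h := memLp_id_gaussianReal' (μ := 0) (v := 1) 4 (by norm_num)
  have h2 := h.integrable_norm_pow (p := 4) (by norm_num)
  rw [memLp_two_iff_integrable_sq (by fun_prop)]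
  refine h2.congr (Filter.Eventually.of_forall fun y => ?_)
  simp only [id, Real.norm_eq_abs]
  rw [← pow_mul]
  exact Even.pow_abs (by decide) y

lemma var_sq_gauss : Var[fun y : ℝ => y ^ 2; gaussianReal 0 1] = 2 := by
  rw [variance_eq_sub memLp_sq_gauss]
  have : ∫ y, ((fun y : ℝ => y ^ 2) ^ 2) y ∂(gaussianReal 0 1) = 3 := by
    rw [← gauss4]; congr 1; ext y; simp only [Pi.pow_apply]; ring
  rw [this, gauss2]; norm_num

lemma memLp_S (d : ℕ) : MemLp (fun g : Fin d → ℝ => ∑ i, g i ^ 2) 2 (gam d) := by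
  apply memLp_finsetSum
  intro i _
  exact memLp_sq_gauss.comp_measurePreserving
    (measurePreserving_eval (fun _ : Fin d => gaussianReal 0 1) i)

lemma int_S (d : ℕ) : ∫ g : Fin d → ℝ, (∑ i, g i ^ 2) ∂(gam d) = d := by
  rw [integral_finsetSum]
  · have : ∀ i : Fin d, ∫ g : Fin d → ℝ, g i ^ 2 ∂(gam d) = 1 := by
      intro i
      rw [← gauss2]
      exact integral_comp_eval (μ := fun _ : Fin d => gaussianReal 0 1) (i := i)
        (f := fun y : ℝ => y ^ 2) (by fun_prop)
    simp [this]
  · intro i _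
    exact (memLp_sq_gauss.comp_measurePreserving
      (measurePreserving_eval (fun _ : Fin d => gaussianReal 0 1) i)).integrable (by norm_num)

lemma var_S (d : ℕ) : Var[fun g : Fin d → ℝ => ∑ i, g i ^ 2; gam d] = 2 * d := by
  have := variance_sum_pi (μ := fun _ : Fin d => gaussianReal 0 1)
    (X := fun _ y => y ^ 2) (fun _ => memLp_sq_gauss)
  have e : (fun g : Fin d → ℝ => ∑ i, g i ^ 2) = ∑ i, fun ω : Fin d → ℝ ↦ ω i ^ 2 := by
    ext g; simp
  rw [e, gam, this]
  simp [var_sq_gauss]; ring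

lemma R_upper {d : ℕ} (hd : 0 < d) : 3 / 4 ≤ (gam d).real {g | enorm2 g ≤ 2 * Real.sqrt d} := by
  have hd' : (0 : ℝ) < d := by exact_mod_cast hd
  have h := mul_meas_ge_le_integral_of_nonneg (μ := gam d)
    (f := fun g : Fin d → ℝ => ∑ i, g i ^ 2)
    (Filter.Eventually.of_forall fun g => Finset.sum_nonneg fun i _ => sq_nonneg _)
    ((memLp_S d).integrable (by norm_num)) (4 * d)
  rw [int_S] at h
  have h1 : (gam d).real {g | 4 * (d : ℝ) ≤ ∑ i, g i ^ 2} ≤ 1 / 4 := by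
    by_contra hc; push Not at hc; nlinarith
  have h2 := probReal_compl_eq_one_sub (μ := gam d) (s := {g | enorm2 g ≤ 2 * Real.sqrt d})
    (measurableSet_le measurable_enorm2 measurable_const)
  have h3 : (gam d).real {g | enorm2 g ≤ 2 * Real.sqrt d}ᶜ ≤
      (gam d).real {g | 4 * (d : ℝ) ≤ ∑ i, g i ^ 2} := by
    refine measureReal_mono ?_ (measure_ne_top _ _)
    intro g hg
    have hg' : 2 * Real.sqrt d < enorm2 g := not_le.1 hg
    have : (2 * Real.sqrt d) ^ 2 ≤ enorm2 g ^ 2 := by gcongr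
    unfold enorm2 at this
    rw [Real.sq_sqrt (Finset.sum_nonneg fun i _ => sq_nonneg _), mul_pow, Real.sq_sqrt hd'.le] at this
    show 4 * (d : ℝ) ≤ ∑ i, g i ^ 2
    linarith
  linarith

lemma R_lower {d : ℕ} (hd : 10 ≤ d) :
    9 / 29 ≤ (gam d).real {g | Real.sqrt (0.7 * d) ≤ enorm2 g} := by
  have hd' : (10 : ℝ) ≤ d := by exact_mod_cast hd
  set S : (Fin d → ℝ) → ℝ := fun g => ∑ i, g i ^ 2 with hS
  have hL := memLp_S d
  have hi : Integrable S (gam d) := hL.integrable (by norm_num)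
  have hv : ∫ g, (S g - d) ^ 2 ∂(gam d) = 2 * d := by
    have := var_S d
    rw [variance_eq_integral hL.aemeasurable, int_S] at this
    exact this
  have hi2 : Integrable (fun g => (S g - d) ^ 2) (gam d) :=
    (hL.sub (memLp_const (d : ℝ))).integrable_sq
  have he : (fun g => (20 / 3 + d - S g) ^ 2) =
      fun g => ((S g - d) ^ 2 + (40 / 3) * (d - S g)) + (20 / 3) ^ 2 := by ext g; ring
  have hf0 : Integrable (fun g => (40 / 3) * (d - S g)) (gam d) :=
    ((integrable_const _).sub hi).const_mul _
  have hfi : Integrable (fun g => (20 / 3 + d - S g) ^ 2) (gam d) := by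
    rw [he]; exact (hi2.add hf0).add (integrable_const _)
  have hf : ∫ g, (20 / 3 + d - S g) ^ 2 ∂(gam d) = 2 * (d : ℝ) + 400 / 9 := by
    have hs : Integrable (fun g => (S g - d) ^ 2 + (40 / 3) * (d - S g)) (gam d) := hi2.add hf0
    rw [he, integral_add hs (integrable_const _), integral_add hi2 hf0, hv,
      integral_const_mul, integral_sub (integrable_const _) hi, int_S]
    simp; norm_num
  have h := mul_meas_ge_le_integral_of_nonneg (μ := gam d)
    (Filter.Eventually.of_forall fun g => sq_nonneg (20 / 3 + d - S g)) hfi ((20 / 3 + 0.3 * d) ^ 2)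
  rw [hf] at h
  set P := (gam d).real {x | (20 / 3 + 0.3 * (d : ℝ)) ^ 2 ≤ (20 / 3 + d - S x) ^ 2} with hP
  have h1 : P ≤ 20 / 29 := by
    by_contra hc; push Not at hc
    have : (20 / 3 + 0.3 * (d : ℝ)) ^ 2 * (20 / 29) < (20 / 3 + 0.3 * d) ^ 2 * P := by gcongr
    nlinarith
  have h2 := probReal_compl_eq_one_sub (μ := gam d) (s := {g | Real.sqrt (0.7 * d) ≤ enorm2 g})
    (measurableSet_le measurable_const measurable_enorm2)
  have h3 : (gam d).real {g | Real.sqrt (0.7 * d) ≤ enorm2 g}ᶜ ≤ P := by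
    refine measureReal_mono ?_ (measure_ne_top _ _)
    intro g hg
    have hg' : enorm2 g < Real.sqrt (0.7 * d) := not_le.1 hg
    have : S g < 0.7 * d := by
      unfold enorm2 at hg'
      exact (Real.sqrt_lt_sqrt_iff (Finset.sum_nonneg fun i _ => sq_nonneg _)).1 hg'
    show (20 / 3 + 0.3 * (d : ℝ)) ^ 2 ≤ (20 / 3 + d - S g) ^ 2
    apply pow_le_pow_left₀ <;> linarith
  linarith

lemma exists_median (ν : Measure ℝ) [IsProbabilityMeasure ν] :
    ∃ m, 1 / 2 ≤ ν.real (Set.Iic m) ∧ 1 / 2 ≤ ν.real (Set.Ici m) := by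
  set A : Set ℝ := {x | 1 / 2 ≤ cdf ν x} with hA
  have hne : A.Nonempty := by
    have := (tendsto_cdf_atTop ν).eventually (lt_mem_nhds (show (1 / 2 : ℝ) < 1 by norm_num))
    obtain ⟨x, hx⟩ := this.exists
    exact ⟨x, hx.le⟩
  have hbd : BddBelow A := by
    have := (tendsto_cdf_atBot ν).eventually (gt_mem_nhds (show (0 : ℝ) < 1 / 2 by norm_num))
    obtain ⟨x, hx⟩ := this.exists
    refine ⟨x, fun y hy => ?_⟩
    by_contra hc
    push Not at hc
    have h1 : cdf ν y ≤ cdf ν x := monotone_cdf ν hc.le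
    have h2 : 1 / 2 ≤ cdf ν y := hy
    linarith
  set m := sInf A
  have hgt : ∀ x, m < x → 1 / 2 ≤ cdf ν x := by
    intro x hx
    obtain ⟨y, hy, hyx⟩ := exists_lt_of_csInf_lt hne hx
    exact le_trans (show 1 / 2 ≤ cdf ν y from hy) (monotone_cdf ν hyx.le)
  have hm : 1 / 2 ≤ cdf ν m := by
    have ht : Filter.Tendsto (cdf ν) (nhdsWithin m (Set.Ioi m)) (nhds (cdf ν m)) :=
      ((cdf ν).right_continuous m).mono_left (nhdsWithin_mono _ Set.Ioi_subset_Ici_self)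
    refine ge_of_tendsto ht ?_
    filter_upwards [self_mem_nhdsWithin] with x hx using hgt x hx
  refine ⟨m, by rwa [cdf_eq_real] at hm, ?_⟩
  have hl : Function.leftLim (cdf ν) m ≤ 1 / 2 := by
    refine le_of_tendsto ((monotone_cdf ν).tendsto_leftLim m) ?_
    filter_upwards [self_mem_nhdsWithin] with x hx
    by_contra hc
    push Not at hc
    exact absurd (csInf_le hbd (show x ∈ A from hc.le)) (not_le.2 hx)
  have := (cdf ν).measure_Ici (tendsto_cdf_atTop ν) m
  rw [measure_cdf] at this
  rw [Measure.real, this, ENNReal.toReal_ofReal] <;> linarith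

lemma exists_r0 {d : ℕ} (hd : 10 ≤ d) : ∃ r : ℝ, 0 < r ∧ 0.7 * d ≤ r ^ 2 ∧
    1 / 2 ≤ (gam d).real {g | enorm2 g ≤ r} ∧ 9 / 29 ≤ (gam d).real {g | r ≤ enorm2 g} := by
  have hd' : (10 : ℝ) ≤ d := by exact_mod_cast hd
  have hp : 0 < Real.sqrt (0.7 * d) := Real.sqrt_pos.2 (by linarith)
  by_cases h : 1 / 2 ≤ (gam d).real {g | enorm2 g ≤ Real.sqrt (0.7 * d)}
  · exact ⟨_, hp, by rw [Real.sq_sqrt (by linarith)], h, R_lower hd⟩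
  · have : IsProbabilityMeasure ((gam d).map enorm2) :=
      Measure.isProbabilityMeasure_map measurable_enorm2.aemeasurable
    obtain ⟨m, h1, h2⟩ := exists_median ((gam d).map enorm2)
    rw [map_measureReal_apply measurable_enorm2 measurableSet_Iic] at h1
    rw [map_measureReal_apply measurable_enorm2 measurableSet_Ici] at h2
    have hm : Real.sqrt (0.7 * d) < m := by
      by_contra hc
      push Not at hc
      apply h
      refine h1.trans (measureReal_mono ?_ (measure_ne_top _ _))
      intro g hg
      exact le_trans (show enorm2 g ≤ m from hg) hc
    refine ⟨m, hp.trans hm, ?_, h1, le_trans (by norm_num) h2⟩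
    have := pow_le_pow_left₀ hp.le hm.le 2
    rwa [Real.sq_sqrt (by linarith)] at this

lemma measurable_linf {d : ℕ} : Measurable (linf : (Fin d → ℝ) → ℝ) := by
  apply measurable_of_Iic
  intro a
  by_cases ha : 0 ≤ a
  · have : linf ⁻¹' Set.Iic a = ⋂ i, {x : Fin d → ℝ | |x i| ≤ a} := by
      ext x; simp [linf_le_iff _ ha]
    rw [this]
    exact MeasurableSet.iInter fun i => measurableSet_le (by fun_prop) measurable_const
  · have : linf ⁻¹' Set.Iic a = (∅ : Set (Fin d → ℝ)) := by
      ext x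
      simp only [Set.mem_preimage, Set.mem_Iic, Set.mem_empty_iff_false, iff_false]
      have := linf_nonneg x
      linarith
    rw [this]; exact MeasurableSet.empty

lemma prod_le {d : ℕ} (μ : Measure (Fin d → ℝ)) [IsProbabilityMeasure μ]
    (hsph : μ {x | enorm2 x = 1} = 1)
    (hinv : ∀ T ∈ Matrix.orthogonalGroup (Fin d) ℝ, μ.map T.mulVec = μ)
    (A B E : Set (Fin d → ℝ)) (hE : MeasurableSet E)
    (h : ∀ g ∈ A, ∀ x ∈ B, enorm2 g • x ∈ E) : (gam d).real A * μ.real B ≤ (gam d).real E := by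
  have hm : Measurable (fun p : (Fin d → ℝ) × (Fin d → ℝ) => enorm2 p.1 • p.2) :=
    (measurable_enorm2.comp measurable_fst).smul measurable_snd
  conv_rhs => rw [← rep μ hsph hinv]
  rw [map_measureReal_apply hm hE, ← measureReal_prod_prod]
  refine measureReal_mono ?_ (measure_ne_top _ _)
  rintro ⟨g, x⟩ ⟨hg, hx⟩
  exact h g hg x hx

lemma exp28 : (16.438 : ℝ) ≤ Real.exp 2.8 := by
  have h2 := Real.log_two_lt_d9
  have : Real.exp 2.8 = 16 * Real.exp (2.8 - 4 * Real.log 2) := by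
    have e : Real.exp (4 * Real.log 2) = 16 := by
      rw [show (4 : ℝ) * Real.log 2 = Real.log 2 * (4 : ℕ) by push_cast; ring, Real.exp_mul,
        Real.exp_log (by norm_num), Real.rpow_natCast]
      norm_num
    rw [Real.exp_sub, e]; ring
  rw [this]
  have := Real.add_one_le_exp (2.8 - 4 * Real.log 2)
  linarith

lemma exp255 : (12.6 : ℝ) ≤ Real.exp 2.55 := by
  have h2 := Real.log_two_lt_d9
  have : Real.exp 2.55 = 8 * Real.exp (2.55 - 3 * Real.log 2) := by
    have e : Real.exp (3 * Real.log 2) = 8 := by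
      rw [show (3 : ℝ) * Real.log 2 = Real.log 2 * (3 : ℕ) by push_cast; ring, Real.exp_mul,
        Real.exp_log (by norm_num), Real.rpow_natCast]
      norm_num
    rw [Real.exp_sub, e]; ring
  rw [this]
  have := Real.quadratic_le_exp_of_nonneg (show 0 ≤ 2.55 - 3 * Real.log 2 by linarith)
  nlinarith

lemma pow_le_exp' {d : ℕ} (s : ℝ) : (1 - qt s) ^ d ≤ Real.exp (-(d * qt s)) := by
  rw [show -(d * qt s) = (d : ℕ) * (-qt s) by ring, Real.exp_nat_mul]
  apply pow_le_pow_left₀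
  · linarith [qt_le_one s]
  · linarith [Real.add_one_le_exp (-qt s)]

lemma sph_compl {d : ℕ} (μ : Measure (Fin d → ℝ)) [IsProbabilityMeasure μ]
    (hsph : μ {x | enorm2 x = 1} = 1) : μ.real {x | enorm2 x = 1}ᶜ = 0 := by
  have hm : MeasurableSet {x : Fin d → ℝ | enorm2 x = 1} :=
    measurable_enorm2 (measurableSet_singleton 1)
  rw [probReal_compl_eq_one_sub hm, Measure.real, hsph]
  simp

lemma sph_meet {d : ℕ} (μ : Measure (Fin d → ℝ)) [IsProbabilityMeasure μ]
    (hsph : μ {x | enorm2 x = 1} = 1) (B S : Set (Fin d → ℝ)) (hB : μ.real B < 1 / 2)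
    (hS : 1 / 2 ≤ μ.real S) : ∃ x, enorm2 x = 1 ∧ x ∈ S ∧ x ∉ B := by
  by_contra hc
  push Not at hc
  have h0 := sph_compl μ hsph
  have : μ.real S ≤ μ.real (B ∪ {x | enorm2 x = 1}ᶜ) := by
    refine measureReal_mono ?_ (measure_ne_top _ _)
    intro x hx
    by_cases h : enorm2 x = 1
    · left; exact hc x h hx
    · right; exact h
  have h2 := measureReal_union_le (μ := μ) B {x | enorm2 x = 1}ᶜ
  linarith

lemma tails {d : ℕ} (hd : 10 ≤ d) (μ : Measure (Fin d → ℝ)) [IsProbabilityMeasure μ]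
    (hsph : μ {x | enorm2 x = 1} = 1)
    (hinv : ∀ T ∈ Matrix.orthogonalGroup (Fin d) ℝ, μ.map T.mulVec = μ) (c : ℝ)
    (hc1 : 1 / 2 ≤ μ.real {x | c ≤ linf x}) (hc2 : 1 / 2 ≤ μ.real {x | linf x ≤ c}) :
    μ.real {x | linf x < c - 2 / Real.sqrt d} + μ.real {x | c + 2 / Real.sqrt d < linf x} ≤ 0.44 := by
  have hd0 : 0 < d := by omega
  have hd' : (10 : ℝ) ≤ d := by exact_mod_cast hd
  have hcw : 1 / Real.sqrt d ≤ c := by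
    obtain ⟨x, hx, hxc, -⟩ := sph_meet μ hsph ∅ _ (by simp) hc2
    exact (linf_ge hd0 x hx).trans hxc
  obtain ⟨r, hr, hr2, hp2, hp1⟩ := exists_r0 hd
  set w := Real.sqrt d with hw
  have hw0 : 0 < w := Real.sqrt_pos.2 (by linarith)
  have hww : w ^ 2 = d := Real.sq_sqrt (by linarith)
  have hc0 : 0 < c := lt_of_lt_of_le (by positivity) hcw
  set β := r / w with hβ
  have hβ0 : 0 < β := by positivity
  have hβ2 : 0.7 ≤ β ^ 2 := by
    rw [hβ, div_pow, hww, le_div_iff₀ (by linarith)]; exact hr2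
  have hrw : r * (1 / w) = β := by rw [hβ]; ring
  have hrw2 : r * (2 / w) = 2 * β := by rw [hβ]; ring
  set a := r * c with ha
  have haβ : β ≤ a := by rw [← hrw]; exact mul_le_mul_of_nonneg_left hcw hr.le
  have hexp : 16.438 ≤ Real.exp (4 * β ^ 2) :=
    exp28.trans (Real.exp_le_exp.2 (by linarith))
  have hlog := Real.log_two_lt_d9
  have hgE : ∀ s, MeasurableSet {x : Fin d → ℝ | s ≤ linf x} := fun s =>
    measurableSet_le measurable_const measurable_linf
  have hlE : ∀ s, MeasurableSet {x : Fin d → ℝ | linf x ≤ s} := fun s =>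
    measurableSet_le measurable_linf measurable_const
  -- (A)
  have hA : d * qt a ≤ 1.386295 := by
    have h1 := prod_le μ hsph hinv {g | enorm2 g ≤ r} {x | linf x ≤ c} {x | linf x ≤ a} (hlE a) (by
      intro g hg x hx
      show linf _ ≤ a
      rw [linf_smul _ (enorm2_nonneg g)]
      exact mul_le_mul hg hx (linf_nonneg x) hr.le)
    rw [gam_linf_le a (by linarith)] at h1
    have h2 := h1.trans (pow_le_exp' a)
    have h3 : (1 / 2 : ℝ) * (1 / 2) ≤ Real.exp (-(d * qt a)) :=
      (mul_le_mul hp2 hc2 (by norm_num) measureReal_nonneg).trans h2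
    have h4 := Real.log_le_log (by norm_num) h3
    rw [Real.log_exp, Real.log_mul (by norm_num) (by norm_num), one_div, Real.log_inv] at h4
    linarith
  -- (B)
  have hB : 9 / 58 ≤ d * qt a := by
    have h1 := prod_le μ hsph hinv {g | r ≤ enorm2 g} {x | c ≤ linf x} {x | a ≤ linf x} (hgE a) (by
      intro g hg x hx
      show a ≤ linf _
      rw [linf_smul _ (enorm2_nonneg g)]
      exact mul_le_mul hg hx hc0.le (enorm2_nonneg g))
    have h2 := h1.trans (gam_linf_ge hd0 a)
    have h3 := (mul_le_mul hp1 hc1 (by norm_num) measureReal_nonneg).trans h2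
    linarith
  -- (C)
  have hC : μ.real {x | c + 2 / w < linf x} ≤ 0.273 := by
    have h1 := prod_le μ hsph hinv {g | r ≤ enorm2 g} {x | c + 2 / w < linf x}
      {x | a + 2 * β ≤ linf x} (hgE _) (by
      intro g hg x hx
      show a + 2 * β ≤ linf _
      rw [linf_smul _ (enorm2_nonneg g)]
      have : r * (c + 2 / w) ≤ enorm2 g * linf x :=
        mul_le_mul hg (le_of_lt hx) (by positivity) (enorm2_nonneg g)
      rw [mul_add, hrw2] at this
      exact this)
    have h2 := h1.trans (gam_linf_ge hd0 _)
    have h3 := qt_shift a (2 * β) (by linarith) (by linarith)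
    have h4 : Real.exp (-(2 * β * a + (2 * β) ^ 2 / 2)) ≤ 1 / 16.438 := by
      have : Real.exp (-(2 * β * a + (2 * β) ^ 2 / 2)) ≤ Real.exp (-(4 * β ^ 2)) := by
        apply Real.exp_le_exp.2; nlinarith
      refine this.trans ?_
      rw [Real.exp_neg, ← one_div]
      exact one_div_le_one_div_of_le (by norm_num) hexp
    have h5 : d * qt (a + 2 * β) ≤ 1 / 16.438 * 1.386295 := by
      calc d * qt (a + 2 * β) ≤ d * (1 / 16.438 * qt a) := by
            apply mul_le_mul_of_nonneg_left _ (by linarith)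
            exact h3.trans (mul_le_mul_of_nonneg_right h4 (qt_nonneg a))
        _ = 1 / 16.438 * (d * qt a) := by ring
        _ ≤ _ := by gcongr
    have h6 := mul_le_mul_of_nonneg_right hp1
      (measureReal_nonneg (μ := μ) (s := {x | c + 2 / w < linf x}))
    have h7 := h6.trans (h2.trans h5)
    norm_num at h7 ⊢
    linarith
  -- (D)
  have hD : μ.real {x | linf x < c - 2 / w} ≤ 0.16 := by
    by_cases hcase : c - 2 / w < 1 / w
    · have : μ.real {x | linf x < c - 2 / w} ≤ μ.real {x | enorm2 x = 1}ᶜ := by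
        refine measureReal_mono ?_ (measure_ne_top _ _)
        intro x hx hx1
        have := linf_ge hd0 x hx1
        have h' : linf x < c - 2 / w := hx
        linarith
      rw [sph_compl μ hsph] at this
      exact this.trans (by norm_num)
    · push Not at hcase
      have hcp : 0 < c - 2 / w := lt_of_lt_of_le (by positivity) hcase
      set s := a - 2 * β with hs
      have hsr : s = r * (c - 2 / w) := by rw [mul_sub, hrw2]
      have hsβ : β ≤ s := by
        rw [hsr, ← hrw]; exact mul_le_mul_of_nonneg_left hcase hr.le
      have h1 := prod_le μ hsph hinv {g | enorm2 g ≤ r} {x | linf x < c - 2 / w} {x | linf x ≤ s}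
        (hlE s) (by
        intro g hg x hx
        show linf _ ≤ s
        rw [linf_smul _ (enorm2_nonneg g), hsr]
        exact mul_le_mul hg (le_of_lt hx) (linf_nonneg x) hr.le)
      rw [gam_linf_le s (by linarith)] at h1
      have h2 := h1.trans (pow_le_exp' s)
      have h3 := qt_shift s (2 * β) (by linarith) (by linarith)
      rw [show s + 2 * β = a by rw [hs]; ring] at h3
      have h4 : Real.exp (-(2 * β * s + (2 * β) ^ 2 / 2)) ≤ 1 / 16.438 := by
        have : Real.exp (-(2 * β * s + (2 * β) ^ 2 / 2)) ≤ Real.exp (-(4 * β ^ 2)) := by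
          apply Real.exp_le_exp.2; nlinarith
        refine this.trans ?_
        rw [Real.exp_neg, ← one_div]
        exact one_div_le_one_div_of_le (by norm_num) hexp
      have h5 : d * qt a ≤ 1 / 16.438 * (d * qt s) := by
        calc d * qt a ≤ d * (1 / 16.438 * qt s) := by
              apply mul_le_mul_of_nonneg_left _ (by linarith)
              exact h3.trans (mul_le_mul_of_nonneg_right h4 (qt_nonneg s))
          _ = 1 / 16.438 * (d * qt s) := by ring
      have h6 : 2.55 ≤ d * qt s := by
        have := hB.trans h5
        norm_num at this ⊢
        linarith
      have h7 : Real.exp (-(d * qt s)) ≤ 1 / 12.6 := by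
        rw [Real.exp_neg, ← one_div]
        exact one_div_le_one_div_of_le (by norm_num)
          (exp255.trans (Real.exp_le_exp.2 h6))
      have h8 := mul_le_mul_of_nonneg_right hp2
        (measureReal_nonneg (μ := μ) (s := {x | linf x < c - 2 / w}))
      have h9 := h8.trans (h2.trans h7)
      norm_num at h9 ⊢
      linarith
  norm_num at hC hD ⊢
  linarith

lemma small_fail {d : ℕ} (hd : 0 < d) (μ : Measure (Fin d → ℝ)) [IsProbabilityMeasure μ]
    (hsph : μ {x | enorm2 x = 1} = 1)
    (hinv : ∀ T ∈ Matrix.orthogonalGroup (Fin d) ℝ, μ.map T.mulVec = μ) :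
    μ.real {x | ((Finset.univ.filter fun i => 1 / (1000 * Real.sqrt d) < |x i|).card : ℝ) ≤
      (d : ℝ) / 2} ≤ 0.02 := by
  have hd' : (0 : ℝ) < d := by exact_mod_cast hd
  have hw0 : 0 < Real.sqrt d := Real.sqrt_pos.2 hd'
  set τ := 1 / (1000 * Real.sqrt d) with hτ
  have hτ0 : 0 < τ := by positivity
  have hτw : 2 * Real.sqrt d * τ = 1 / 500 := by rw [hτ]; field_simp; norm_num
  set A : Fin d → Set (Fin d → ℝ) := fun i => {x | |x i| ≤ τ} with hA
  have hAm : ∀ i, MeasurableSet (A i) := fun i => measurableSet_le (by fun_prop) measurable_const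
  have h1 : ∀ i, μ.real (A i) ≤ 2 / 375 := by
    intro i
    have hm : MeasurableSet {y : ℝ | |y| ≤ 1 / 500} := measurableSet_le (by fun_prop) measurable_const
    have h := prod_le μ hsph hinv {g | enorm2 g ≤ 2 * Real.sqrt d} (A i)
      {g | g i ∈ {y : ℝ | |y| ≤ 1 / 500}} (measurable_pi_apply i hm) (by
      intro g hg x hx
      show |enorm2 g * x i| ≤ 1 / 500
      rw [abs_mul, abs_of_nonneg (enorm2_nonneg g), ← hτw]
      exact mul_le_mul hg hx (abs_nonneg _) (by positivity))
    rw [gam_eval i hm] at h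
    have h2 := gauss_small (1 / 500) (by norm_num)
    have h3 := mul_le_mul_of_nonneg_right (R_upper hd) (measureReal_nonneg (μ := μ) (s := A i))
    linarith
  set N : (Fin d → ℝ) → ℝ := fun x => ∑ i, (A i).indicator 1 x with hN
  have hint : ∀ i ∈ (Finset.univ : Finset (Fin d)),
      Integrable (fun x => (A i).indicator (1 : (Fin d → ℝ) → ℝ) x) μ :=
    fun i _ => (integrable_const (1 : ℝ)).indicator (hAm i)
  have hNi : Integrable N μ := integrable_finsetSum _ hint
  have hNv : ∫ x, N x ∂μ ≤ d * (2 / 375) := by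
    rw [hN, integral_finsetSum _ hint]
    calc _ ≤ ∑ i : Fin d, (2 / 375 : ℝ) := Finset.sum_le_sum fun i _ => by
          rw [integral_indicator_one (hAm i)]; exact h1 i
      _ = _ := by simp
  have hM := mul_meas_ge_le_integral_of_nonneg (μ := μ) (f := N)
    (Filter.Eventually.of_forall fun x => Finset.sum_nonneg fun i _ =>
      Set.indicator_nonneg (fun _ _ => zero_le_one) _) hNi (d / 2)
  have hsub : μ.real {x : Fin d → ℝ | ((Finset.univ.filter fun i => τ < |x i|).card : ℝ) ≤
      (d : ℝ) / 2} ≤ μ.real {x | (d : ℝ) / 2 ≤ N x} := by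
    refine measureReal_mono ?_ (measure_ne_top _ _)
    intro x hx
    have hx' : ((Finset.univ.filter fun i => τ < |x i|).card : ℝ) ≤ (d : ℝ) / 2 := hx
    show (d : ℝ) / 2 ≤ N x
    have e : N x = d - ((Finset.univ.filter fun i => τ < |x i|).card : ℝ) := by
      rw [Finset.card_filter, hN]
      push_cast
      have : (d : ℝ) = ∑ i : Fin d, (1 : ℝ) := by simp
      rw [this, ← Finset.sum_sub_distrib]
      refine Finset.sum_congr rfl fun i _ => ?_
      by_cases h : |x i| ≤ τ
      · have : x ∈ A i := h
        simp [this, not_lt.2 h]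
      · have : x ∉ A i := h
        simp [this, not_le.1 h]
    rw [e]; linarith
  refine hsub.trans ?_
  by_contra hc
  push Not at hc
  norm_num at hc
  nlinarith

lemma bad_small {d : ℕ} (hd0 : 0 < d) (μ : Measure (Fin d → ℝ)) [IsProbabilityMeasure μ]
    (hsph : μ {x | enorm2 x = 1} = 1)
    (hinv : ∀ T ∈ Matrix.orthogonalGroup (Fin d) ℝ, μ.map T.mulVec = μ) (c : ℝ)
    (hc1 : 1 / 2 ≤ μ.real {x | c ≤ linf x}) (hc2 : 1 / 2 ≤ μ.real {x | linf x ≤ c}) :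
    μ.real {x | enorm2 x = 1 ∧ ¬ |linf x - c| ≤ 2 / Real.sqrt d} ≤ 0.44 := by
  by_cases hd : 10 ≤ d
  · have h := tails hd μ hsph hinv c hc1 hc2
    refine le_trans ?_ h
    refine le_trans (measureReal_mono ?_ (measure_ne_top _ _)) (measureReal_union_le _ _)
    rintro x ⟨-, hx⟩
    by_contra hn
    apply hx
    rw [Set.mem_union, not_or] at hn
    have h1 : ¬ linf x < c - 2 / Real.sqrt d := hn.1
    have h2 : ¬ c + 2 / Real.sqrt d < linf x := hn.2
    rw [abs_le]; constructor <;> linarith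
  · have hd' : (0 : ℝ) < d := by exact_mod_cast hd0
    have hw0 : 0 < Real.sqrt d := Real.sqrt_pos.2 hd'
    have hw3 : Real.sqrt d ≤ 3 := by
      rw [Real.sqrt_le_left (by norm_num)]
      have : (d : ℝ) ≤ 9 := by exact_mod_cast (by omega : d ≤ 9)
      linarith
    have h3 : 1 ≤ 3 * (1 / Real.sqrt d) := by
      rw [mul_one_div, le_div_iff₀ hw0]; linarith
    have h2 : 2 / Real.sqrt d = 2 * (1 / Real.sqrt d) := by ring
    obtain ⟨x, hx, hxc, -⟩ := sph_meet μ hsph ∅ _ (by simp) hc2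
    obtain ⟨y, hy, hyc, -⟩ := sph_meet μ hsph ∅ _ (by simp) hc1
    have hxc' : linf x ≤ c := hxc
    have hyc' : c ≤ linf y := hyc
    have a1 := linf_ge hd0 x hx
    have a2 := linf_le_one y hy
    have : {x | enorm2 x = 1 ∧ ¬ |linf x - c| ≤ 2 / Real.sqrt d} = (∅ : Set (Fin d → ℝ)) := by
      ext z
      simp only [Set.mem_empty_iff_false, iff_false]
      rintro ⟨hz, hn⟩
      apply hn
      have b1 := linf_ge hd0 z hz
      have b2 := linf_le_one z hz
      rw [h2, abs_le]; constructor <;> linarith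
    rw [this]; norm_num

lemma half_real {d : ℕ} {μ : Measure (Fin d → ℝ)} [IsProbabilityMeasure μ] {S : Set (Fin d → ℝ)}
    (h : (1 : ℝ≥0∞) / 2 ≤ μ S) : 1 / 2 ≤ μ.real S := by
  have := ENNReal.toReal_mono (measure_ne_top μ S) h
  simpa [Measure.real] using this

/-- For every `d > 0` and every symmetric norm `l` on `ℝ^d`, there is a vector `x ∈ S^{d-1}`
simultaneously satisfying `|‖x‖_∞ − M_{ℓ∞}| ≤ 2/√d`, `|l(x) − M_l| ≤ 2 b_l/√d`, and more than
`d/2` coordinates of `x` exceed `1/(K√d)` in absolute value, for a universal constant `K`.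
The medians `Minf`, `M` are with respect to the Haar (rotation-invariant) probability
measure `μ` on the sphere, and `b` is the maximum of `l` on the sphere. -/
theorem stmt2 : ∃ K : ℝ, 0 < K ∧
    ∀ (d : ℕ), 0 < d → ∀ (l : (Fin d → ℝ) → ℝ), IsSymmetricNorm l →
    ∀ (μ : Measure (Fin d → ℝ)), IsProbabilityMeasure μ →
    μ {x | enorm2 x = 1} = 1 →
    (∀ T ∈ Matrix.orthogonalGroup (Fin d) ℝ, μ.map T.mulVec = μ) →
    ∀ (Minf M b : ℝ),
    (1 : ℝ≥0∞) / 2 ≤ μ {x | Minf ≤ linf x} →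
    (1 : ℝ≥0∞) / 2 ≤ μ {x | linf x ≤ Minf} →
    (1 : ℝ≥0∞) / 2 ≤ μ {x | M ≤ l x} →
    (1 : ℝ≥0∞) / 2 ≤ μ {x | l x ≤ M} →
    (∀ x, enorm2 x = 1 → l x ≤ b) →
    (∃ x, enorm2 x = 1 ∧ l x = b) →
    ∃ x : Fin d → ℝ, enorm2 x = 1 ∧
      |linf x - Minf| ≤ 2 / Real.sqrt d ∧
      |l x - M| ≤ 2 * b / Real.sqrt d ∧
      (d : ℝ) / 2 <
        ((Finset.univ.filter fun i => 1 / (K * Real.sqrt d) < |x i|).card : ℝ) := by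
  refine ⟨1000, by norm_num, ?_⟩
  intro d hd l hl μ hμ hsph hinv Minf M b hc1 hc2 hM1 hM2 hb1 hb2
  set B1 : Set (Fin d → ℝ) := {x | enorm2 x = 1 ∧ ¬ |linf x - Minf| ≤ 2 / Real.sqrt d} with hB1
  set B2 : Set (Fin d → ℝ) := {x | ((Finset.univ.filter fun i =>
    1 / (1000 * Real.sqrt d) < |x i|).card : ℝ) ≤ (d : ℝ) / 2} with hB2
  have hB : μ.real (B1 ∪ B2) < 1 / 2 := by
    have h1 := bad_small hd μ hsph hinv Minf (half_real hc1) (half_real hc2)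
    have h2 := small_fail hd μ hsph hinv
    have h3 := measureReal_union_le (μ := μ) B1 B2
    refine lt_of_le_of_lt (h3.trans (add_le_add h1 h2)) (by norm_num)
  obtain ⟨x, hx, hxM, hxB⟩ := sph_meet μ hsph _ _ hB (half_real hM2)
  obtain ⟨y, hy, hyM, hyB⟩ := sph_meet μ hsph _ _ hB (half_real hM1)
  have key : ∀ z, enorm2 z = 1 → z ∉ B1 ∪ B2 → |linf z - Minf| ≤ 2 / Real.sqrt d ∧
      (d : ℝ) / 2 < ((Finset.univ.filter fun i =>
        1 / (1000 * Real.sqrt d) < |z i|).card : ℝ) := by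
    intro z hz hzB
    rw [Set.mem_union, not_or] at hzB
    refine ⟨?_, not_le.1 hzB.2⟩
    by_contra hn
    exact hzB.1 ⟨hz, hn⟩
  obtain ⟨hx1, hx3⟩ := key x hx hxB
  obtain ⟨hy1, hy3⟩ := key y hy hyB
  obtain ⟨z, hz, hz1, hz2, hz3⟩ := ivt_main hd l hl x y M Minf (1 / (1000 * Real.sqrt d))
    (2 / Real.sqrt d) hx hy hx1 hy1 hxM hyM hx3 hy3
  refine ⟨z, hz, hz1, ?_, hz3⟩
  rw [hz2, sub_self, abs_zero]
  obtain ⟨u, -, hu⟩ := hb2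
  have : 0 ≤ b := hu ▸ l_nonneg hl u
  positivity
end

section
/- Suppose for a vector v = q − x with layer sizes (b_k)_{k∈[P]} and estimated sizes (c_k)_{k∈[P]} we have: (a) c_k ≤ b_k for all k; (b) c_k ≥ (1−ε₁)b_k for every β-contributing layer k, with ε₁ = O(ε²/log d) and β = O(ε²/log d), and P = O(log(d)/ε). Let J(v) be the layer vector built from the counts (c_k) and L(v) the true layer vector. Then (1 − O(ε))·l(v) ≤ l(J(v)) ≤ (1 + O(ε))·l(v) for any symmetric norm l and base α = 1 + Θ(ε). -/
def IsLayerVec {d : ℕ} (α : ℝ) (P : ℕ) (b : ℕ → ℕ) (w : Fin d → ℝ) : Prop :=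
  (∀ k ∈ Finset.Icc 1 P, (Finset.univ.filter fun j => w j = α ^ k).card = b k) ∧
  (∀ j, w j = 0 ∨ ∃ k ∈ Finset.Icc 1 P, w j = α ^ k)

noncomputable def layerSize {d : ℕ} (α : ℝ) (v : Fin d → ℝ) (j : ℕ) : ℕ :=
  (Finset.univ.filter fun m => α ^ (j - 1) < |v m| ∧ |v m| ≤ α ^ j).card

namespace S17

theorem l_zero {d : ℕ} {l : (Fin d → ℝ) → ℝ} (hl : IsSymmetricNorm l) : l 0 = 0 := by
  have := hl.2.1 0 0
  simpa using this

theorem l_nonneg {d : ℕ} {l : (Fin d → ℝ) → ℝ} (hl : IsSymmetricNorm l) (x : Fin d → ℝ) :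
    0 ≤ l x := by
  by_cases h : x = 0
  · rw [h, l_zero hl]
  · exact (hl.2.2.1 x h).le

theorem l_sum {d : ℕ} {l : (Fin d → ℝ) → ℝ} (hl : IsSymmetricNorm l) {ι : Type*}
    (s : Finset ι) (f : ι → Fin d → ℝ) : l (∑ i ∈ s, f i) ≤ ∑ i ∈ s, l (f i) := by
  classical
  induction s using Finset.induction_on with
  | empty => simp [l_zero hl]
  | insert a s ha ih =>
    rw [Finset.sum_insert ha, Finset.sum_insert ha]
    exact (hl.1 _ _).trans (by linarith)

theorem l_update {d : ℕ} {l : (Fin d → ℝ) → ℝ} (hl : IsSymmetricNorm l) (z : Fin d → ℝ)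
    (i : Fin d) (a : ℝ) (h0 : 0 ≤ a) (h : a ≤ z i) : l (Function.update z i a) ≤ l z := by
  by_cases hz : z i = 0
  · have : a = z i := by linarith
    rw [this, Function.update_eq_self]
  have hzp : 0 < z i := lt_of_le_of_ne (by linarith) (Ne.symm hz)
  set t := a / z i with ht
  have ht0 : 0 ≤ t := by positivity
  have ht1 : t ≤ 1 := by rw [ht, div_le_one hzp]; exact h
  have hta : t * z i = a := by rw [ht]; field_simp
  have hf : l (Function.update z i (-(z i))) = l z := by
    rw [← hl.2.2.2.2 z, ← hl.2.2.2.2 (Function.update z i (-(z i)))]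
    congr 1
    funext j
    by_cases hj : j = i
    · subst hj; simp
    · simp [hj]
  have he : Function.update z i a
      = ((1 + t) / 2) • z + ((1 - t) / 2) • Function.update z i (-(z i)) := by
    funext j
    by_cases hj : j = i
    · subst hj
      simp only [Function.update_self, Pi.add_apply, Pi.smul_apply, smul_eq_mul]
      linarith
    · simp only [Function.update_of_ne hj, Pi.add_apply, Pi.smul_apply, smul_eq_mul]
      ring
  rw [he]
  refine (hl.1 _ _).trans ?_
  rw [hl.2.1, hl.2.1, hf, abs_of_nonneg (by linarith), abs_of_nonneg (by linarith)]
  apply le_of_eq; ring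

theorem l_mono {d : ℕ} {l : (Fin d → ℝ) → ℝ} (hl : IsSymmetricNorm l) (x y : Fin d → ℝ)
    (h0 : ∀ i, 0 ≤ x i) (h : ∀ i, x i ≤ y i) : l x ≤ l y := by
  classical
  have key : ∀ s : Finset (Fin d), l (s.piecewise x y) ≤ l y := by
    intro s
    induction s using Finset.induction_on with
    | empty => simp
    | insert a s ha ih =>
      rw [Finset.piecewise_insert]
      refine (l_update hl _ a _ (h0 a) ?_).trans ih
      rw [Finset.piecewise_eq_of_notMem _ _ _ ha]
      exact h a
  simpa using key Finset.univ

theorem perm_of_layer {d : ℕ} {α : ℝ} {P : ℕ} {b : ℕ → ℕ} {w w' : Fin d → ℝ}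
    (hα : 0 < α) (h : IsLayerVec α P b w) (h' : IsLayerVec α P b w') :
    ∃ σ : Equiv.Perm (Fin d), ∀ i, w' (σ i) = w i := by
  classical
  set t : Finset ℝ := (Finset.Icc 1 P).image (fun k => α ^ k) with ht
  have h0t : (0:ℝ) ∉ t := by
    simp only [ht, Finset.mem_image, not_exists, not_and]
    intro k _ hk
    exact (pow_pos hα k).ne' hk
  have htc : ∀ x ∈ t, (Finset.univ.filter fun j => w j = x).card
      = (Finset.univ.filter fun j => w' j = x).card := by
    intro x hx
    obtain ⟨k, hk, rfl⟩ := Finset.mem_image.1 hx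
    rw [h.1 k hk, h'.1 k hk]
  have hm : ∀ (u : Fin d → ℝ), IsLayerVec α P b u → ∀ j, u j ∈ insert 0 t := by
    intro u hu j
    rcases hu.2 j with h1 | ⟨k, hk, h1⟩
    · simp [h1]
    · rw [h1]; exact Finset.mem_insert_of_mem (Finset.mem_image_of_mem _ hk)
  have hs : ∀ (u : Fin d → ℝ), IsLayerVec α P b u → d =
      (Finset.univ.filter fun j => u j = 0).card
        + ∑ x ∈ t, (Finset.univ.filter fun j => u j = x).card := by
    intro u hu
    have := Finset.card_eq_sum_card_fiberwise (s := (Finset.univ : Finset (Fin d))) (f := u)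
      (t := insert 0 t) (fun j _ => hm u hu j)
    rw [Finset.sum_insert h0t] at this
    simpa using this
  have hall : ∀ x, (Finset.univ.filter fun j => w j = x).card
      = (Finset.univ.filter fun j => w' j = x).card := by
    intro x
    by_cases hx : x ∈ t
    · exact htc x hx
    by_cases hx0 : x = 0
    · subst hx0
      have e1 := hs w h
      have e2 := hs w' h'
      rw [Finset.sum_congr rfl htc] at e1
      omega
    · have : ∀ (u : Fin d → ℝ), IsLayerVec α P b u →
          (Finset.univ.filter fun j => u j = x).card = 0 := by
        intro u hu
        rw [Finset.card_eq_zero, Finset.filter_eq_empty_iff]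
        intro j _ hj
        have := hm u hu j
        rw [hj, Finset.mem_insert] at this
        tauto
      rw [this w h, this w' h']
  have e : ∀ x, Nonempty ({a // w a = x} ≃ {a // w' a = x}) := by
    intro x
    rw [← Fintype.card_eq, Fintype.card_subtype, Fintype.card_subtype]
    exact hall x
  exact ⟨Equiv.ofFiberEquiv (fun x => (e x).some), fun i => Equiv.ofFiberEquiv_map _ i⟩

theorem l_layer {d : ℕ} {l : (Fin d → ℝ) → ℝ} (hl : IsSymmetricNorm l)
    {α : ℝ} {P : ℕ} {b : ℕ → ℕ} {w w' : Fin d → ℝ}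
    (hα : 0 < α) (h : IsLayerVec α P b w) (h' : IsLayerVec α P b w') : l w = l w' := by
  obtain ⟨σ, hσ⟩ := perm_of_layer hα h h'
  rw [← hl.2.2.2.1 σ w']
  congr 1
  funext i
  exact (hσ i).symm

theorem avg {d : ℕ} {l : (Fin d → ℝ) → ℝ} (hl : IsSymmetricNorm l) (κ : Fin d → ℕ)
    (w z : Fin d → ℝ) (hw : ∀ i, 0 ≤ w i) (hz : ∀ i, 0 ≤ z i)
    (h : ∀ i, z i * ((Finset.univ.filter fun j => κ j = κ i).card : ℝ)
      ≤ ∑ j ∈ Finset.univ.filter (fun j => κ j = κ i), w j) : l z ≤ l w := by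
  classical
  set G : Finset (Equiv.Perm (Fin d)) := Finset.univ.filter (fun σ => ∀ i, κ (σ i) = κ i) with hG
  have hGpos : 0 < (G.card : ℝ) := by
    have : (1 : Equiv.Perm (Fin d)) ∈ G := by simp [hG]
    exact_mod_cast Finset.card_pos.2 ⟨_, this⟩
  set y : Fin d → ℝ := ∑ σ ∈ G, fun i => w (σ i) with hy
  have hyi : ∀ i, y i = ∑ σ ∈ G, w (σ i) := by
    intro i; rw [hy, Finset.sum_apply]
  have h1 : l y ≤ G.card * l w := by
    refine (l_sum hl _ _).trans ?_
    rw [Finset.sum_congr rfl (fun σ _ => hl.2.2.2.1 σ w)]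
    simp
  have hconst : ∀ i j, κ j = κ i → y j = y i := by
    intro i j hij
    rw [hyi, hyi]
    have hsw : ∀ m, κ (Equiv.swap i j m) = κ m := by
      intro m
      rw [Equiv.swap_apply_def]
      split_ifs with a b
      · rw [a, hij]
      · rw [b, hij]
      · rfl
    refine Finset.sum_bij' (fun σ _ => σ * Equiv.swap i j) (fun σ _ => σ * Equiv.swap i j)
      ?_ ?_ ?_ ?_ ?_
    · intro σ hσ
      simp only [hG, Finset.mem_filter, Finset.mem_univ, true_and, Equiv.Perm.mul_apply] at hσ ⊢
      intro m; rw [hσ, hsw]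
    · intro σ hσ
      simp only [hG, Finset.mem_filter, Finset.mem_univ, true_and, Equiv.Perm.mul_apply] at hσ ⊢
      intro m; rw [hσ, hsw]
    · intro σ _; simp [mul_assoc]
    · intro σ _; simp [mul_assoc]
    · intro σ _; simp
  have hsum : ∀ i, y i * ((Finset.univ.filter fun j => κ j = κ i).card : ℝ)
      = G.card * ∑ j ∈ Finset.univ.filter (fun j => κ j = κ i), w j := by
    intro i
    have e1 : ∑ j ∈ Finset.univ.filter (fun j => κ j = κ i), y j
        = y i * ((Finset.univ.filter fun j => κ j = κ i).card : ℝ) := by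
      rw [Finset.sum_congr rfl (g := fun _ => y i)]
      · simp [mul_comm]
      · intro j hj; exact hconst i j (Finset.mem_filter.1 hj).2
    rw [← e1]
    simp_rw [hyi]
    rw [Finset.sum_comm]
    rw [Finset.sum_congr rfl
      (g := fun _ => ∑ j ∈ Finset.univ.filter (fun j => κ j = κ i), w j)]
    · simp
    · intro σ hσ
      have hσ' : ∀ i, κ (σ i) = κ i := by simpa [hG] using hσ
      refine Finset.sum_equiv σ ?_ ?_
      · intro j; simp [hσ']
      · intro j _; rfl
  have hle : ∀ i, (G.card : ℝ) * z i ≤ y i := by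
    intro i
    have hc : 0 < ((Finset.univ.filter fun j => κ j = κ i).card : ℝ) := by
      have : i ∈ (Finset.univ.filter fun j => κ j = κ i) := by simp
      exact_mod_cast Finset.card_pos.2 ⟨_, this⟩
    refine le_of_mul_le_mul_right ?_ hc
    rw [hsum, mul_assoc]
    exact mul_le_mul_of_nonneg_left (h i) hGpos.le
  have h2 : l ((G.card : ℝ) • z) ≤ l y :=
    l_mono hl _ _ (fun i => mul_nonneg hGpos.le (hz i)) hle
  rw [hl.2.1, abs_of_pos hGpos] at h2
  exact le_of_mul_le_mul_left (h2.trans h1) hGpos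

/-- layer vector from an index function -/
theorem layer_mk {d : ℕ} {α : ℝ} (hα : 1 < α) {P : ℕ} (κ : Fin d → ℕ) (hκ : ∀ i, κ i ≤ P)
    (Q : Fin d → Prop) [DecidablePred Q] (hQ : ∀ i, Q i → 1 ≤ κ i) :
    IsLayerVec α P (fun k => (Finset.univ.filter fun j => Q j ∧ κ j = k).card)
      (fun j => if Q j then α ^ κ j else 0) := by
  constructor
  · intro k hk
    congr 1
    ext j
    simp only [Finset.mem_filter, Finset.mem_univ, true_and]
    by_cases hj : Q j
    · simp only [hj, if_true, true_and]
      exact (pow_right_injective₀ (by linarith) hα.ne').eq_iff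
    · simp only [hj, if_false, false_and, iff_false]
      exact (pow_pos (by linarith) k).ne
  · intro j
    by_cases hj : Q j
    · right
      exact ⟨κ j, Finset.mem_Icc.2 ⟨hQ j hj, hκ j⟩, by simp [hj]⟩
    · left; simp [hj]

theorem layer_congr {d : ℕ} {α : ℝ} {P : ℕ} {b b' : ℕ → ℕ} {w : Fin d → ℝ}
    (h : IsLayerVec α P b w) (hb : ∀ k ∈ Finset.Icc 1 P, b k = b' k) : IsLayerVec α P b' w :=
  ⟨fun k hk => (h.1 k hk).trans (hb k hk), h.2⟩

theorem core {d P : ℕ} {l : (Fin d → ℝ) → ℝ} (hl : IsSymmetricNorm l)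
    (v : Fin d → ℝ) (α β ε₁ : ℝ) (c : ℕ → ℕ)
    (LV JV : Fin d → ℝ) (LVk : ℕ → Fin d → ℝ) (hα : 1 < α) (hβ : 0 < β)
    (h1 : 0 < ε₁) (h1' : ε₁ ≤ 1)
    (hv : ∀ j, v j ≠ 0 → 1 < |v j| ∧ |v j| ≤ α ^ P)
    (hLV : IsLayerVec α P (layerSize α v) LV)
    (hJV : IsLayerVec α P c JV)
    (hLVk : ∀ k ∈ Finset.Icc 1 P,
      IsLayerVec α P (fun j => if j = k then layerSize α v k else 0) (LVk k))
    (hc : ∀ k ∈ Finset.Icc 1 P, c k ≤ layerSize α v k)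
    (hcon : ∀ k ∈ Finset.Icc 1 P, β * l LV ≤ l (LVk k) →
      (1 - ε₁) * (layerSize α v k : ℝ) ≤ (c k : ℝ)) :
    (1 - ε₁) * ((1 - P * β) * l LV) ≤ l JV ∧ l v ≤ l LV ∧ l JV ≤ l LV ∧ l LV ≤ α * l v := by
  classical
  have hα0 : 0 < α := by linarith
  have hex : ∀ i, ∃ k, k ≤ P ∧ ((v i = 0 ∧ k = 0) ∨
      (1 ≤ k ∧ α ^ (k - 1) < |v i| ∧ |v i| ≤ α ^ k)) := by
    intro i
    by_cases hi : v i = 0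
    · exact ⟨0, Nat.zero_le _, Or.inl ⟨hi, rfl⟩⟩
    obtain ⟨a, b⟩ := hv i hi
    have hE : ∃ k, |v i| ≤ α ^ k := ⟨P, b⟩
    have hk1 : 1 ≤ Nat.find hE := by
      by_contra hcon
      have h0 : Nat.find hE = 0 := by omega
      have := Nat.find_spec hE
      rw [h0, pow_zero] at this
      linarith
    refine ⟨Nat.find hE, Nat.find_min' hE b, Or.inr ⟨hk1, ?_, Nat.find_spec hE⟩⟩
    exact not_le.1 (Nat.find_min hE (by omega))
  choose κ hκP hκ using hex
  have hsz : ∀ k ∈ Finset.Icc 1 P,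
      (Finset.univ.filter fun m => κ m = k) = Finset.univ.filter
        (fun m => α ^ (k - 1) < |v m| ∧ |v m| ≤ α ^ k) := by
    intro k hk
    have hk1 := (Finset.mem_Icc.1 hk).1
    ext m
    simp only [Finset.mem_filter, Finset.mem_univ, true_and]
    constructor
    · intro hm
      rcases hκ m with ⟨_, h0⟩ | ⟨_, h2⟩
      · omega
      · rwa [hm] at h2
    · rintro ⟨a, b⟩
      rcases hκ m with ⟨h0, _⟩ | ⟨h3, h4, h5⟩
      · rw [h0, abs_zero] at a
        exact absurd a (not_lt.2 (pow_pos hα0 _).le)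
      · have i1 : k - 1 < κ m := (pow_lt_pow_iff_right₀ hα).1 (a.trans_le h5)
        have i2 : κ m - 1 < k := (pow_lt_pow_iff_right₀ hα).1 (h4.trans_le b)
        omega
  have hszc : ∀ k ∈ Finset.Icc 1 P,
      (Finset.univ.filter fun m => κ m = k).card = layerSize α v k := by
    intro k hk; rw [hsz k hk]; rfl
  -- the canonical vector
  set u : Fin d → ℝ := fun j => if 1 ≤ κ j then α ^ κ j else 0 with hu
  have hu0 : ∀ j, 0 ≤ u j := by
    intro j; simp only [hu]; split_ifs
    · positivity
    · exact le_rfl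
  have huL : IsLayerVec α P (layerSize α v) u := by
    refine layer_congr (layer_mk hα κ hκP (fun j => 1 ≤ κ j) (fun _ h => h)) ?_
    intro k hk
    rw [← hszc k hk]
    congr 1
    ext j
    have := (Finset.mem_Icc.1 hk).1
    simp only [Finset.mem_filter, Finset.mem_univ, true_and]
    omega
  have hluv : l LV = l u := l_layer hl hα0 hLV huL
  have hvu : ∀ j, |v j| ≤ u j := by
    intro j
    rcases hκ j with ⟨a, b⟩ | ⟨a, _, b⟩
    · simp [hu, a, b]
    · simp [hu, a, b]
  have huv : ∀ j, u j ≤ α * |v j| := by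
    intro j
    rcases hκ j with ⟨a, b⟩ | ⟨a, b, _⟩
    · simp [hu, a, b]
    · simp only [hu, a, if_true]
      have : α ^ κ j = α * α ^ (κ j - 1) := by
        rw [← pow_succ']; congr 1; omega
      rw [this]
      exact mul_le_mul_of_nonneg_left b.le hα0.le
  have r1 : l v ≤ l LV := by
    rw [hluv, ← hl.2.2.2.2 v]
    exact l_mono hl _ _ (fun i => abs_nonneg _) hvu
  have r2 : l LV ≤ α * l v := by
    rw [hluv, ← hl.2.2.2.2 v]
    have := hl.2.1 α (fun i => |v i|)
    rw [abs_of_pos hα0] at this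
    rw [← this]
    exact l_mono hl _ _ hu0 huv
  -- subsets
  have hS : ∀ k, ∃ S : Finset (Fin d), k ∈ Finset.Icc 1 P →
      S ⊆ (Finset.univ.filter fun m => κ m = k) ∧ S.card = c k := by
    intro k
    by_cases hk : k ∈ Finset.Icc 1 P
    · obtain ⟨S, hS⟩ := Finset.exists_subset_card_eq ((hc k hk).trans (hszc k hk).ge)
      exact ⟨S, fun _ => hS⟩
    · exact ⟨∅, fun h => absurd h hk⟩
  choose S hS using hS
  set w : Fin d → ℝ := fun j => if 1 ≤ κ j ∧ j ∈ S (κ j) then α ^ κ j else 0 with hw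
  have hfS : ∀ k ∈ Finset.Icc 1 P,
      (Finset.univ.filter fun j => (1 ≤ κ j ∧ j ∈ S (κ j)) ∧ κ j = k) = S k := by
    intro k hk
    have hk1 := (Finset.mem_Icc.1 hk).1
    ext j
    simp only [Finset.mem_filter, Finset.mem_univ, true_and]
    constructor
    · rintro ⟨⟨_, h⟩, rfl⟩; exact h
    · intro h
      have : κ j = k := by simpa using (hS k hk).1 h
      rw [this]; exact ⟨⟨hk1, h⟩, rfl⟩
  have hwL : IsLayerVec α P c w := by
    refine layer_congr (layer_mk hα κ hκP (fun j => 1 ≤ κ j ∧ j ∈ S (κ j)) (fun _ h => h.1)) ?_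
    intro k hk
    simp only [hfS k hk]
    exact (hS k hk).2
  have hlw : l JV = l w := l_layer hl hα0 hJV hwL
  have hw0 : ∀ j, 0 ≤ w j := by
    intro j; simp only [hw]; split_ifs
    · positivity
    · exact le_rfl
  have hwu : ∀ j, w j ≤ u j := by
    intro j
    simp only [hw, hu]
    by_cases a : 1 ≤ κ j <;> by_cases b : j ∈ S (κ j) <;> simp [a, b] <;> positivity
  have r3 : l JV ≤ l LV := by
    rw [hlw, hluv]; exact l_mono hl _ _ hw0 hwu
  refine ⟨?_, r1, r3, r2⟩
  -- layer k of u
  have hk_eq : ∀ k ∈ Finset.Icc 1 P, l (LVk k) = l (fun j => if κ j = k then u j else 0) := by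
    intro k hk
    have hk1 := (Finset.mem_Icc.1 hk).1
    refine l_layer hl hα0 (hLVk k hk) ?_
    have := layer_mk hα κ hκP (fun j => κ j = k) (fun j hj => by omega)
    have e : (fun j => if κ j = k then α ^ κ j else 0) = (fun j => if κ j = k then u j else 0) := by
      funext j
      by_cases hj : κ j = k
      · have : 1 ≤ κ j := by omega
        simp only [hu]
        rw [if_pos hj, if_pos hj, if_pos this]
      · simp [hj]
    rw [e] at this
    refine layer_congr this ?_
    intro m hm
    by_cases hmk : m = k
    · subst hmk
      simp only [if_true, and_self]
      exact hszc m hm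
    · simp only [hmk, if_false, Finset.card_eq_zero, Finset.filter_eq_empty_iff]
      rintro j _ ⟨a, b⟩
      omega
  set T : Finset ℕ := (Finset.Icc 1 P).filter (fun k => β * l LV ≤ l (LVk k)) with hT
  set N : Finset ℕ := (Finset.Icc 1 P).filter (fun k => ¬ β * l LV ≤ l (LVk k)) with hN
  set uT : Fin d → ℝ := fun j => if κ j ∈ T then u j else 0 with huT
  have huT0 : ∀ j, 0 ≤ uT j := by
    intro j; simp only [huT]; split_ifs
    · exact hu0 j
    · exact le_rfl
  have hdec : u = uT + ∑ k ∈ N, fun j => if κ j = k then u j else 0 := by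
    funext j
    rw [Pi.add_apply, Finset.sum_apply, Finset.sum_ite_eq]
    simp only [huT]
    by_cases h1 : 1 ≤ κ j
    · have hm : κ j ∈ Finset.Icc 1 P := Finset.mem_Icc.2 ⟨h1, hκP j⟩
      by_cases h2 : β * l LV ≤ l (LVk (κ j))
      · simp [hT, hN, h2, h1, hκP j]
      · simp [hT, hN, h2, h1, hκP j]
    · have : u j = 0 := by simp only [hu]; rw [if_neg h1]
      simp [this]
  have hNb : ∑ k ∈ N, l (fun j => if κ j = k then u j else 0) ≤ P * (β * l LV) := by
    have : ∑ k ∈ N, l (fun j => if κ j = k then u j else 0) ≤ ∑ k ∈ N, β * l LV := by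
      refine Finset.sum_le_sum fun k hk => ?_
      obtain ⟨a, b⟩ := Finset.mem_filter.1 hk
      rw [← hk_eq k a]
      exact (not_le.1 b).le
    refine this.trans ?_
    rw [Finset.sum_const, nsmul_eq_mul]
    refine mul_le_mul_of_nonneg_right ?_ (mul_nonneg hβ.le (l_nonneg hl _))
    have : N.card ≤ (Finset.Icc 1 P).card := Finset.card_filter_le _ _
    rw [Nat.card_Icc] at this
    exact_mod_cast this
  have hT1 : (1 - P * β) * l LV ≤ l uT := by
    have a := hl.1 uT (∑ k ∈ N, fun j => if κ j = k then u j else 0)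
    rw [← hdec] at a
    have b := l_sum hl N (fun k j => if κ j = k then u j else 0)
    have e : l u = l LV := hluv.symm
    linarith
  have hfin : (1 - ε₁) * l uT ≤ l w := by
    have := hl.2.1 (1 - ε₁) uT
    rw [abs_of_nonneg (by linarith)] at this
    rw [← this]
    refine avg hl κ w _ hw0 (fun i => mul_nonneg (by linarith) (huT0 i)) ?_
    intro i
    by_cases hi : κ i ∈ T
    · obtain ⟨hm, hb⟩ := Finset.mem_filter.1 hi
      have hi1 := (Finset.mem_Icc.1 hm).1
      have e : ∑ j ∈ Finset.univ.filter (fun j => κ j = κ i), w j = c (κ i) * α ^ κ i := by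
        rw [← (hS _ hm).2, ← hfS _ hm, Finset.card_filter, Finset.sum_filter]
        push_cast
        rw [Finset.sum_mul]
        refine Finset.sum_congr rfl fun j _ => ?_
        simp only [hw]
        by_cases hj : κ j = κ i
        · rw [hj]; simp
        · simp [hj]
      rw [e, hszc _ hm]
      have e2 : uT i = α ^ κ i := by
        simp only [huT, hu]; rw [if_pos hi, if_pos hi1]
      rw [Pi.smul_apply, smul_eq_mul, e2]
      have := mul_le_mul_of_nonneg_right (hcon _ hm hb) (pow_pos hα0 (κ i)).le
      linarith
    · have e2 : uT i = 0 := by simp only [huT]; rw [if_neg hi]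
      rw [Pi.smul_apply, e2, smul_zero, zero_mul]
      exact Finset.sum_nonneg fun j _ => hw0 j
  rw [hlw]
  exact (mul_le_mul_of_nonneg_left hT1 (by linarith)).trans hfin

end S17

/-- Correctness of the layer-vector estimate: if the estimated layer sizes `c k` satisfy
`c k ≤ b k` for all layers and `c k ≥ (1−ε₁)·b k` for every `β`-contributing layer, with
`ε₁, β = O(ε²/log d)`, `P = O(log d/ε)` layers and base `α = 1 + Θ(ε)`, then the norm of
the estimated layer vector `J(v)` (here `JV`) is a `(1 ± O(ε))`-approximation of `l(v)`.
`LV` is the true layer vector `L(v)` and `LVk k` the layer-`k`-only vector `L_k(v)`. -/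
theorem stmt17 : ∀ ca cb cp : ℝ, 0 < ca → 0 < cb → 0 < cp → ∃ C : ℝ, 0 < C ∧
    ∀ (d P : ℕ) (l : (Fin d → ℝ) → ℝ), IsSymmetricNorm l →
    ∀ (v : Fin d → ℝ) (α β ε ε₁ : ℝ) (c : ℕ → ℕ)
      (LV JV : Fin d → ℝ) (LVk : ℕ → Fin d → ℝ),
    0 < ε → ε < 1 → 2 ≤ d →
    1 + ε / ca ≤ α → α ≤ 1 + ca * ε →
    0 < β → β ≤ cb * ε ^ 2 / Real.log d →
    0 < ε₁ → ε₁ ≤ cb * ε ^ 2 / Real.log d →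
    (P : ℝ) ≤ cp * Real.log d / ε →
    (∀ j, v j ≠ 0 → 1 < |v j| ∧ |v j| ≤ α ^ P) →
    IsLayerVec α P (layerSize α v) LV →
    IsLayerVec α P c JV →
    (∀ k ∈ Finset.Icc 1 P,
      IsLayerVec α P (fun j => if j = k then layerSize α v k else 0) (LVk k)) →
    (∀ k ∈ Finset.Icc 1 P, c k ≤ layerSize α v k) →
    (∀ k ∈ Finset.Icc 1 P, β * l LV ≤ l (LVk k) →
      (1 - ε₁) * (layerSize α v k : ℝ) ≤ (c k : ℝ)) →
    (1 - C * ε) * l v ≤ l JV ∧ l JV ≤ (1 + C * ε) * l v := by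
  intro ca cb cp hca hcb hcp
  have hlog2 : 0 < Real.log 2 := Real.log_pos (by norm_num)
  have hC : 0 < cb / Real.log 2 := by positivity
  refine ⟨ca + cb * cp + cb / Real.log 2, by positivity, ?_⟩
  intro d P l hl v α β ε ε₁ c LV JV LVk hε hε1 hd hα1 hα2 hβ hβ2 h1 h12 hP hv hLV hJV hLVk hc hcon
  have hd2 : (2:ℝ) ≤ d := by exact_mod_cast hd
  have hlogd : Real.log 2 ≤ Real.log d := Real.log_le_log (by norm_num) hd2
  have hlogp : 0 < Real.log d := by linarith
  have hα : 1 < α := by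
    have : 0 < ε / ca := by positivity
    linarith
  have he1 : ε₁ ≤ cb / Real.log 2 * ε := by
    refine h12.trans ?_
    rw [div_mul_eq_mul_div]
    refine div_le_div₀ (by positivity) ?_ hlog2 hlogd
    exact mul_le_mul_of_nonneg_left (by nlinarith) hcb.le
  have hPb : P * β ≤ cb * cp * ε := by
    have : (P:ℝ) * β ≤ (cp * Real.log d / ε) * (cb * ε ^ 2 / Real.log d) :=
      mul_le_mul hP hβ2 hβ.le (by positivity)
    refine this.trans (le_of_eq ?_)
    field_simp
  have hlv := S17.l_nonneg hl v
  have hlJ := S17.l_nonneg hl JV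
  have hp1 : 0 < ca * ε := by positivity
  have hp2 : 0 < cb * cp * ε := by positivity
  have hp3 : 0 < cb / Real.log 2 * ε := by positivity
  have hPb0 : 0 ≤ P * β := by positivity
  have hexp : (ca + cb * cp + cb / Real.log 2) * ε
      = ca * ε + cb * cp * ε + cb / Real.log 2 * ε := by ring
  rw [hexp]
  -- upper bound does not need `ε₁ ≤ 1`
  by_cases he : ε₁ ≤ 1
  · obtain ⟨a1, a2, a3, a4⟩ := S17.core hl v α β ε₁ c LV JV LVk hα hβ h1 he hv hLV hJV hLVk hc hcon
    constructor
    · by_cases hneg : 1 - (ca * ε + cb * cp * ε + cb / Real.log 2 * ε) ≤ 0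
      · exact (mul_nonpos_of_nonpos_of_nonneg hneg hlv).trans hlJ
      · refine le_trans ?_ a1
        rw [← mul_assoc]
        refine mul_le_mul ?_ a2 hlv ?_
        · nlinarith [mul_nonneg h1.le hPb0]
        · exact mul_nonneg (by linarith) (by linarith)
    · refine (a3.trans a4).trans (mul_le_mul_of_nonneg_right (by linarith) hlv)
  · obtain ⟨a1, a2, a3, a4⟩ := S17.core hl v α β 1 c LV JV LVk hα hβ one_pos le_rfl hv hLV hJV
      hLVk hc (fun k _ _ => by simp)
    constructor
    · exact (mul_nonpos_of_nonpos_of_nonneg (by linarith) hlv).trans hlJ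
    · refine (a3.trans a4).trans (mul_le_mul_of_nonneg_right (by linarith) hlv)
end
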